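/- arXiv:2601.07097 — 2 statements merged into one kernel-verified Lean document; each statement's English description precedes it below -/
import Mathlib

section
/- For every fixed base b ≥ 2, there exist infinitely many positive integers n that are square-free (i.e. μ(n)² = 1, equivalently no prime p satisfies p² ∣ n) and are palindromes in base b. -/
/-- A positive integer `n` is a base-`b` palindrome if `b ∤ n` and its base-`b`
digit string reads the same forwards and backwards. -/
def IsBPalindrome (b n : ℕ) : Prop := ¬ b ∣ n ∧ (Nat.digits b n).Palindrome

/-- The reversal of the `j` lowest base-`b` digits of `u`. -/
def digitRev (b : ℕ) : ℕ → ℕ → ℕ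
  | 0, _ => 0
  | j + 1, u => (u % b) * b ^ j + digitRev b j (u / b)

lemma digitRev_lt {b : ℕ} (hb : 0 < b) (j u : ℕ) : digitRev b j u < b ^ j := by
  induction j generalizing u with
  | zero => simp [digitRev]
  | succ j ih =>
    have h1 := ih (u / b)
    have h2 : u % b + 1 ≤ b := Nat.mod_lt u hb
    have h3 : (u % b + 1) * b ^ j ≤ b * b ^ j := Nat.mul_le_mul_right _ h2
    simp only [digitRev, pow_succ]
    nlinarith

lemma digitRev_concat {b : ℕ} (hb : 0 < b) (i j x y : ℕ) (hy : y < b ^ j) :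
    digitRev b (i + j) (x * b ^ j + y) = digitRev b j y * b ^ i + digitRev b i x := by
  induction j generalizing y with
  | zero =>
    have : y = 0 := by simpa using hy
    subst this
    simp [digitRev]
  | succ j ih =>
    have hy' : y / b < b ^ j := by
      rw [Nat.div_lt_iff_lt_mul hb]
      simpa [pow_succ] using hy
    have h1 : (x * b ^ (j + 1) + y) % b = y % b := by
      rw [pow_succ, ← mul_assoc, add_comm, Nat.add_mul_mod_self_right]
    have h2 : (x * b ^ (j + 1) + y) / b = x * b ^ j + y / b := by
      rw [pow_succ, ← mul_assoc, add_comm, Nat.add_mul_div_right _ _ hb, add_comm]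
    rw [← add_assoc, digitRev, h1, h2, ih _ hy', digitRev]
    ring

lemma digitRev_digitRev {b : ℕ} (hb : 0 < b) (j u : ℕ) (hu : u < b ^ j) :
    digitRev b j (digitRev b j u) = u := by
  induction j generalizing u with
  | zero => simp [digitRev] at hu ⊢; omega
  | succ j ih =>
    have hu' : u / b < b ^ j := by
      rw [Nat.div_lt_iff_lt_mul hb]
      simpa [pow_succ] using hu
    have h := digitRev_concat hb 1 j (u % b) (digitRev b j (u / b)) (digitRev_lt hb j _)
    rw [add_comm 1 j] at h
    rw [show digitRev b (j + 1) u = u % b * b ^ j + digitRev b j (u / b) from rfl, h, ih _ hu']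
    simp [digitRev, Nat.div_add_mod']

lemma digitRev_ofDigits {b : ℕ} (hb : 0 < b) (l : List ℕ) (hl : ∀ x ∈ l, x < b) :
    digitRev b l.length (Nat.ofDigits b l) = Nat.ofDigits b l.reverse := by
  induction l with
  | nil => simp [digitRev]
  | cons h t ih =>
    have hh : h < b := hl h (by simp)
    have h1 : (h + b * Nat.ofDigits b t) % b = h := by
      rw [Nat.add_mul_mod_self_left, Nat.mod_eq_of_lt hh]
    have h2 : (h + b * Nat.ofDigits b t) / b = Nat.ofDigits b t := by
      rw [Nat.add_mul_div_left _ _ hb, Nat.div_eq_of_lt hh, zero_add]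
    rw [List.length_cons, digitRev, Nat.ofDigits_cons]
    rw [h1, h2, ih fun x hx => hl x (by simp [hx]), List.reverse_cons, Nat.ofDigits_append]
    simp [Nat.ofDigits_singleton]
    ring

/-- The number with `2k+1` base-`b` digits whose `k+1` leading digits are those of `a` and whose
`k` lowest digits mirror the `k` leading digits of `a`. -/
def mirror (b k a : ℕ) : ℕ := a * b ^ k + digitRev b k (a / b)

lemma digitRev_mirror {b : ℕ} (hb : 0 < b) (k a : ℕ) (ha : a < b ^ (k + 1)) :
    digitRev b (2 * k + 1) (mirror b k a) = mirror b k a := by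
  have ha' : a / b < b ^ k := by
    rw [Nat.div_lt_iff_lt_mul hb]
    simpa [pow_succ] using ha
  have h := digitRev_concat hb (k + 1) k a _ (digitRev_lt hb k (a / b))
  rw [show k + 1 + k = 2 * k + 1 by ring, digitRev_digitRev hb k _ ha',
    show digitRev b (k + 1) a = a % b * b ^ k + digitRev b k (a / b) from rfl] at h
  rw [mirror, h]
  have e : a * b ^ k = (a / b * b + a % b) * b ^ k := by rw [Nat.div_add_mod']
  rw [e, pow_succ]
  ring

lemma mirror_lt {b : ℕ} (hb : 0 < b) (k a : ℕ) (ha : a < b ^ (k + 1)) :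
    mirror b k a < b ^ (2 * k + 1) := by
  have h := digitRev_lt hb k (a / b)
  have h2 : (a + 1) * b ^ k ≤ b ^ (k + 1) * b ^ k := Nat.mul_le_mul_right _ ha
  rw [mirror, show 2 * k + 1 = k + 1 + k by ring, pow_add b (k + 1)]
  linarith

lemma isBPalindrome_mirror {b : ℕ} (hb : 2 ≤ b) (k a : ℕ) (ha : b ^ k ≤ a)
    (ha' : a < b ^ (k + 1)) (hdvd : ¬ b ∣ mirror b k a) : IsBPalindrome b (mirror b k a) := by
  refine ⟨hdvd, ?_⟩
  have hb0 : 0 < b := by omega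
  have hlt := mirror_lt hb0 k a ha'
  have hge : b ^ (2 * k) ≤ mirror b k a := by
    have := Nat.mul_le_mul_right (b ^ k) ha
    rw [mirror, two_mul, pow_add]
    omega
  have hlen : (Nat.digits b (mirror b k a)).length = 2 * k + 1 := by
    apply le_antisymm
    · exact (Nat.digits_length_le_iff (by omega) _).2 hlt
    · exact (Nat.lt_digits_length_iff (by omega) _).2 hge
  have h := digitRev_ofDigits hb0 (Nat.digits b (mirror b k a))
    fun x hx => Nat.digits_lt_base (by omega) hx
  rw [hlen, Nat.ofDigits_digits, digitRev_mirror hb0 k a ha'] at h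
  apply List.Palindrome.of_reverse_eq
  apply Nat.ofDigits_inj_of_len_eq (b := b) (by omega) (by simp)
  · intro x hx
    exact Nat.digits_lt_base (by omega) (List.mem_reverse.1 hx)
  · intro x hx
    exact Nat.digits_lt_base (by omega) hx
  · rw [← h, Nat.ofDigits_digits]

/-- Peeling off the `j` outermost digits on both sides. -/
lemma mirror_peel {b : ℕ} (hb : 0 < b) (j r x w : ℕ) (hw : w < b ^ (r + 1)) :
    mirror b (j + r) (x * b ^ (r + 1) + w) =
      x * b ^ (2 * r + 1 + j) + b ^ j * mirror b r w + digitRev b j x := by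
  have hw' : w / b < b ^ r := by
    rw [Nat.div_lt_iff_lt_mul hb]
    simpa [pow_succ] using hw
  have h2 : (x * b ^ (r + 1) + w) / b = x * b ^ r + w / b := by
    rw [pow_succ, ← mul_assoc, add_comm, Nat.add_mul_div_right _ _ hb, add_comm]
  rw [mirror, h2, digitRev_concat hb _ _ _ _ hw', mirror]
  ring

lemma card_sq_le_card_mul_card_fiber_pairs {α β : Type*} [DecidableEq α] [DecidableEq β]
    (S : Finset α) (B : Finset β) (f : α → β) (hf : ∀ x ∈ S, f x ∈ B) :
    S.card ^ 2 ≤ B.card * ((S ×ˢ S).filter fun p => f p.1 = f p.2).card := by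
  have h1 : S.card = ∑ y ∈ B, (S.filter fun x => f x = y).card :=
    Finset.card_eq_sum_card_fiberwise hf
  have h2 : ((S ×ˢ S).filter fun p => f p.1 = f p.2).card =
      ∑ y ∈ B, (S.filter fun x => f x = y).card ^ 2 := by
    rw [Finset.card_eq_sum_card_fiberwise (f := fun p => f p.1) (t := B)]
    · refine Finset.sum_congr rfl fun y _ => ?_
      rw [sq, ← Finset.card_product]
      congr 1
      ext ⟨x, x'⟩
      simp only [Finset.mem_filter, Finset.mem_product]
      constructor
      · rintro ⟨⟨⟨h, h'⟩, e⟩, e'⟩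
        exact ⟨⟨h, e'⟩, h', e ▸ e'⟩
      · rintro ⟨⟨h, e⟩, h', e'⟩
        exact ⟨⟨⟨h, h'⟩, e.trans e'.symm⟩, e⟩
    · intro p hp
      exact hf _ (Finset.mem_product.1 (Finset.mem_filter.1 hp).1).1
  rw [h2, h1]
  exact sq_sum_le_card_mul_sum_sq

lemma card_le_of_congruent_of_close (S : Finset ℕ) (B Λ : ℕ)
    (hS : ∀ d ∈ S, ∀ d' ∈ S, d ≤ d' → d ≡ d' [MOD B] ∧ d' - d ≤ Λ) :
    S.card ≤ Λ / B + 1 := by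
  rcases S.eq_empty_or_nonempty with rfl | hne
  · simp
  set d₀ := S.min' hne
  have hd₀ : d₀ ∈ S := S.min'_mem hne
  have hle : ∀ d ∈ S, d₀ ≤ d := fun d hd => S.min'_le d hd
  calc S.card ≤ (Finset.range (Λ / B + 1)).card := by
        refine Finset.card_le_card_of_injOn (fun d => (d - d₀) / B) ?_ ?_
        · intro d hd
          have := (hS d₀ hd₀ d hd (hle d hd)).2
          simpa [Nat.lt_succ_iff] using Nat.div_le_div_right (c := B) this
        · intro d hd d' hd' h
          have e : ∀ x ∈ S, x = d₀ + B * ((x - d₀) / B) := by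
            intro x hx
            obtain ⟨hc, -⟩ := hS d₀ hd₀ x hx (hle x hx)
            have := Nat.mul_div_cancel' ((Nat.modEq_iff_dvd' (hle x hx)).1 hc)
            have := hle x hx
            omega
          rw [e d hd, e d' hd']
          simp only at h
          rw [h]
    _ = _ := Finset.card_range _

/-- The number of `d` of size about `D` for which `d²` has a multiple that lies in a given residue
class and in a given short interval around `X`. -/
lemma card_square_multiples_le (S : Finset ℕ) (b D B X Y M Λ : ℕ) (Δ : ℤ) (hB : 0 < B)
    (hD : 0 < D) (hYX : 2 * Y ≤ X) (hM : 2 * X ≤ M * D ^ 2)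
    (hΛ : 2 * b ^ 2 * D * Y ≤ Λ * X + X)
    (hS : ∀ d ∈ S, D ≤ d ∧ d < b * D ∧ d.Coprime B ∧
      ∃ m : ℤ, |(d : ℤ) ^ 2 * m - X| < Y ∧ (d : ℤ) ^ 2 * m ≡ Δ [ZMOD B]) :
    S.card ≤ (Λ / B + 1) * (B * (M / B + 1)) := by
  classical
  have hS' : ∀ d : ℕ, ∃ m : ℤ, d ∈ S → |(d : ℤ) ^ 2 * m - X| < Y ∧
      (d : ℤ) ^ 2 * m ≡ Δ [ZMOD B] := by
    intro d
    by_cases hd : d ∈ S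
    · obtain ⟨-, -, -, m, hm⟩ := hS d hd
      exact ⟨m, fun _ => hm⟩
    · exact ⟨0, fun h => absurd h hd⟩
  choose m hm using hS'
  have hpos : ∀ d ∈ S, 0 < m d ∧ m d < M ∧ (X : ℤ) < 2 * b ^ 2 * D ^ 2 * m d := by
    intro d hd
    obtain ⟨h1, h2, -, -⟩ := hS d hd
    obtain ⟨h3, -⟩ := hm d hd
    rw [abs_lt] at h3
    have h1' : (D : ℤ) ≤ d := by exact_mod_cast h1
    have h2' : (d : ℤ) < b * D := by exact_mod_cast h2
    have hD' : (0 : ℤ) < D := by exact_mod_cast hD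
    have hYX' : 2 * (Y : ℤ) ≤ X := by exact_mod_cast hYX
    have hM' : 2 * (X : ℤ) ≤ M * D ^ 2 := by exact_mod_cast hM
    have hmul : 0 < (d : ℤ) ^ 2 * m d := by linarith
    have hm0 : 0 < m d := pos_of_mul_pos_right hmul (sq_nonneg _)
    have hsq : (D : ℤ) ^ 2 ≤ d ^ 2 := pow_le_pow_left₀ hD'.le h1' 2
    have hsq' : (d : ℤ) ^ 2 ≤ (b * D) ^ 2 := pow_le_pow_left₀ (by linarith) h2'.le 2
    refine ⟨hm0, ?_, ?_⟩
    · have := mul_le_mul_of_nonneg_right hsq hm0.le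
      have h4 : (m d) * (D : ℤ) ^ 2 < M * D ^ 2 := by linarith
      exact lt_of_mul_lt_mul_right h4 (sq_nonneg _)
    · have := mul_le_mul_of_nonneg_right hsq' hm0.le
      nlinarith
  have key : S.card ≤ (Λ / B + 1) * (Finset.range B ×ˢ Finset.range (M / B + 1)).card := by
    refine Finset.card_le_mul_card_image_of_maps_to
      (f := fun d => (d % B, (m d).toNat / B)) ?_ _ ?_
    · intro d hd
      obtain ⟨h1, h2, -⟩ := hpos d hd
      simp only [Finset.mem_product, Finset.mem_range]
      refine ⟨Nat.mod_lt _ hB, Nat.lt_succ_of_le (Nat.div_le_div_right ?_)⟩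
      omega
    · rintro ⟨r, j⟩ -
      refine card_le_of_congruent_of_close _ B Λ ?_
      intro d hd d' hd' hle
      simp only [Finset.mem_filter, Prod.mk.injEq] at hd hd'
      obtain ⟨hdS, hr, hj⟩ := hd
      obtain ⟨hdS', hr', hj'⟩ := hd'
      have hmod : d ≡ d' [MOD B] := hr.trans hr'.symm
      refine ⟨hmod, ?_⟩
      obtain ⟨hp, hpM, hpX⟩ := hpos d hdS
      obtain ⟨hp', hpM', hpX'⟩ := hpos d' hdS'
      obtain ⟨ha, hc⟩ := hm d hdS
      obtain ⟨ha', hc'⟩ := hm d' hdS'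
      have hmodZ : (d : ℤ) ≡ d' [ZMOD B] := (Int.natCast_modEq_iff).2 hmod
      have hmm : m d ≡ m d' [ZMOD B] := by
        have h1 : (d : ℤ) ^ 2 * m d ≡ (d : ℤ) ^ 2 * m d' [ZMOD B] :=
          (hc.trans hc'.symm).trans (((hmodZ.pow 2).symm).mul_right _)
        have hcop : IsCoprime (B : ℤ) ((d : ℤ) ^ 2) :=
          ((Nat.isCoprime_iff_coprime.2 (hS d hdS).2.2.1).pow_left).symm
        rw [Int.modEq_iff_dvd, ← mul_sub] at h1
        exact Int.modEq_iff_dvd.2 (hcop.dvd_of_dvd_mul_left h1)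
      have hme : m d = m d' := by
        have e1 := Int.emod_add_mul_ediv (m d) B
        have e2 := Int.emod_add_mul_ediv (m d') B
        have hq : m d / B = m d' / B := by
          have h1 : ((m d).toNat : ℤ) = m d := Int.toNat_of_nonneg hp.le
          have h2 : ((m d').toNat : ℤ) = m d' := Int.toNat_of_nonneg hp'.le
          rw [← h1, ← h2, ← Int.natCast_ediv, ← Int.natCast_ediv, hj, hj']
        rw [← e1, ← e2, hq, hmm]
      rw [← hme] at ha'
      rw [abs_lt] at ha ha'
      have hD1 : (D : ℤ) ≤ d := by exact_mod_cast (hS d hdS).1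
      have hle' : (d : ℤ) ≤ d' := by exact_mod_cast hle
      have hD0 : (0 : ℤ) < D := by exact_mod_cast hD
      have h5 : ((d' : ℤ) - d) * (D * m d) < Y := by
        have h6 : ((d' : ℤ) ^ 2 - d ^ 2) * m d < 2 * Y := by linarith
        have h7 : ((d' : ℤ) - d) * (2 * D) ≤ d' ^ 2 - d ^ 2 := by nlinarith
        have h8 := mul_le_mul_of_nonneg_right h7 hp.le
        linarith
      have hX0 : (0 : ℤ) < X := by
        rcases Nat.eq_zero_or_pos X with h0 | h0
        · have : Y = 0 := by omega
          subst this
          simp [h0] at ha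
          linarith
        · exact_mod_cast h0
      have h9 : ((d' : ℤ) - d) * X < (Λ + 1) * X := by
        have hΛ' : 2 * (b : ℤ) ^ 2 * D * Y ≤ Λ * X + X := by exact_mod_cast hΛ
        have hbD : 0 < 2 * (b : ℤ) ^ 2 * D := by
          have : 0 < b := by
            rcases Nat.eq_zero_or_pos b with h0 | h0
            · have := (hS d hdS).2.1
              simp [h0] at this
            · exact h0
          positivity
        have h10 := mul_lt_mul_of_pos_left h5 hbD
        have h11 : ((d' : ℤ) - d) * X ≤ (d' - d) * (2 * b ^ 2 * D ^ 2 * m d) :=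
          mul_le_mul_of_nonneg_left hpX.le (by linarith)
        nlinarith
      have h12 := lt_of_mul_lt_mul_right h9 hX0.le
      omega
  simpa using key
/-- The relation between the blocks `u`, `u'` of two mirrored numbers that share the surrounding
blocks and are both divisible by `d²`. -/
def BlockRel (b s t d u u' : ℕ) : Prop :=
  ∃ m E : ℤ, ((u : ℤ) - u') * (b : ℤ) ^ (2 * (s + t) + 1 + 3 * s) + E * (b : ℤ) ^ (4 * s) +
    ((digitRev b (3 * s) u : ℤ) - digitRev b (3 * s) u') = (d : ℤ) ^ 2 * m ∧
    |E| < (b : ℤ) ^ (2 * t + 1)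

lemma BlockRel.symm {b s t d u u' : ℕ} (h : BlockRel b s t d u u') : BlockRel b s t d u' u := by
  obtain ⟨m, E, h, hE⟩ := h
  refine ⟨-m, -E, ?_, by rwa [abs_neg]⟩
  linear_combination -h

lemma card_blockRel_le_of_le {b s t : ℕ} (hb : 2 ≤ b) (hs : 1 ≤ s) (hst : 7 * s ≤ t + 1)
    (u u' : ℕ) (hu : u < b ^ (3 * s)) (huu : u' + b ^ s ≤ u) (S : Finset ℕ)
    (hS : ∀ d ∈ S, b ^ (s + t + 1) ≤ d ∧ d < b ^ (s + t + 2) ∧ d.Coprime b ∧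
      BlockRel b s t d u u') :
    S.card * b ^ (2 * s) ≤ 6 * b ^ (s + t + 3) := by
  have hb0 : 0 < b := by omega
  obtain ⟨a, rfl⟩ : ∃ a, u = u' + a := ⟨u - u', by omega⟩
  have ha : b ^ s ≤ a := by omega
  have ha' : a < b ^ (3 * s) := by omega
  have hbs : 2 ≤ b ^ s := hb.trans (Nat.le_self_pow (by omega) b)
  have ha0 : 0 < a := by omega
  set Λ := 2 * b ^ (s + t + 3) / (a * b ^ s) with hΛ
  have hcard := card_square_multiples_le S b (b ^ (s + t + 1)) (b ^ (4 * s))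
    (a * b ^ (2 * (s + t) + 1 + 3 * s)) (b ^ (2 * t + 1 + 4 * s)) (a * b ^ (3 * s)) Λ
    ((digitRev b (3 * s) (u' + a) : ℤ) - digitRev b (3 * s) u') (by positivity) (by positivity)
    ?_ ?_ ?_ ?_
  · have e1 : Λ / b ^ (4 * s) = 2 * b ^ (s + t + 3) / (a * b ^ (5 * s)) := by
      rw [hΛ, Nat.div_div_eq_div_mul, mul_assoc, ← pow_add]
      congr 3
      ring
    have e2 : a * b ^ (3 * s) / b ^ (4 * s) = a / b ^ s := by
      rw [show 4 * s = s + 3 * s by ring, pow_add, Nat.mul_div_mul_right _ _ (by positivity)]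
    rw [e1, e2] at hcard
    set Q := 2 * b ^ (s + t + 3) / (a * b ^ (5 * s))
    have hQ : Q * (a * b ^ (5 * s)) ≤ 2 * b ^ (s + t + 3) := Nat.div_mul_le_self _ _
    have hA : (a / b ^ s) * b ^ s ≤ a := Nat.div_mul_le_self _ _
    have hp : a * b ^ (5 * s) ≤ b ^ (s + t + 3) :=
      calc a * b ^ (5 * s) ≤ b ^ (3 * s) * b ^ (5 * s) := Nat.mul_le_mul_right _ ha'.le
        _ = b ^ (8 * s) := by rw [← pow_add]; congr 1; ring
        _ ≤ _ := Nat.pow_le_pow_right hb0 (by omega)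
    calc S.card * b ^ (2 * s)
        ≤ (Q + 1) * (b ^ (4 * s) * (a / b ^ s + 1)) * b ^ (2 * s) := Nat.mul_le_mul_right _ hcard
      _ = (Q + 1) * b ^ (5 * s) * ((a / b ^ s) * b ^ s + b ^ s) := by
          rw [show 5 * s = 4 * s + s by ring, show 2 * s = s + s by ring, pow_add, pow_add]
          ring
      _ ≤ (Q + 1) * b ^ (5 * s) * (2 * a) := Nat.mul_le_mul_left _ (by omega)
      _ = 2 * (Q * (a * b ^ (5 * s))) + 2 * (a * b ^ (5 * s)) := by ring
      _ ≤ 6 * b ^ (s + t + 3) := by omega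
  · calc 2 * b ^ (2 * t + 1 + 4 * s) ≤ (a * b ^ s) * b ^ (2 * t + 1 + 4 * s) := by
          apply Nat.mul_le_mul_right
          nlinarith
      _ = _ := by rw [mul_assoc, ← pow_add]; congr 2; ring
  · calc 2 * (a * b ^ (2 * (s + t) + 1 + 3 * s)) ≤ b * (a * b ^ (2 * (s + t) + 1 + 3 * s)) :=
          Nat.mul_le_mul_right _ hb
      _ = _ := by ring
  · have h1 : 2 * b ^ (s + t + 3) < (a * b ^ s) * (Λ + 1) :=
      Nat.lt_mul_div_succ _ (by positivity)
    calc 2 * b ^ 2 * b ^ (s + t + 1) * b ^ (2 * t + 1 + 4 * s)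
        = (2 * b ^ (s + t + 3)) * b ^ (2 * t + 1 + 4 * s) := by ring
      _ ≤ (a * b ^ s) * (Λ + 1) * b ^ (2 * t + 1 + 4 * s) := Nat.mul_le_mul_right _ h1.le
      _ = _ := by ring
  · intro d hd
    obtain ⟨h1, h2, h3, m, E, h4, h5⟩ := hS d hd
    refine ⟨h1, by rw [← pow_succ']; exact h2, h3.pow_right _, m, ?_, ?_⟩
    · rw [← h4]
      have r1 : (digitRev b (3 * s) (u' + a) : ℤ) < (b : ℤ) ^ (4 * s) := by
        exact_mod_cast (digitRev_lt hb0 _ _).trans_le (Nat.pow_le_pow_right hb0 (by omega))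
      have r2 : (digitRev b (3 * s) u' : ℤ) < (b : ℤ) ^ (4 * s) := by
        exact_mod_cast (digitRev_lt hb0 _ _).trans_le (Nat.pow_le_pow_right hb0 (by omega))
      have r3 : (0 : ℤ) ≤ (digitRev b (3 * s) (u' + a) : ℤ) := by positivity
      have r4 : (0 : ℤ) ≤ (digitRev b (3 * s) u' : ℤ) := by positivity
      have hBpos : (0 : ℤ) < (b : ℤ) ^ (4 * s) := by positivity
      rw [abs_lt] at h5 ⊢
      obtain ⟨h5, h6⟩ := h5
      have h5' : -(b : ℤ) ^ (2 * t + 1) + 1 ≤ E := by omega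
      have h6' : E ≤ (b : ℤ) ^ (2 * t + 1) - 1 := by omega
      have h7 := mul_le_mul_of_nonneg_right h5' hBpos.le
      have h8 := mul_le_mul_of_nonneg_right h6' hBpos.le
      push_cast
      rw [pow_add (b : ℤ) (2 * t + 1) (4 * s)]
      constructor <;> nlinarith
    · rw [← h4]
      apply Int.ModEq.symm
      rw [Int.modEq_iff_dvd]
      refine ⟨(a : ℤ) * (b : ℤ) ^ (s + 2 * t + 1) + E, ?_⟩
      push_cast
      ring

lemma card_near_le (N h : ℕ) :
    ((Finset.range N ×ˢ Finset.range N).filter fun p => p.1 < p.2 + h ∧ p.2 < p.1 + h).card ≤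
      N * (2 * h) := by
  have : ((Finset.range N ×ˢ Finset.range N).filter fun p => p.1 < p.2 + h ∧ p.2 < p.1 + h).card ≤
      2 * h * (Finset.range N).card := by
    refine Finset.card_le_mul_card_image_of_maps_to (f := Prod.fst) ?_ _ ?_
    · intro p hp
      exact (Finset.mem_product.1 (Finset.mem_filter.1 hp).1).1
    · intro u _
      calc _ ≤ (Finset.Ico (u + 1 - h) (u + h)).card := by
            refine Finset.card_le_card_of_injOn Prod.snd ?_ ?_
            · rintro ⟨x, y⟩ hp
              simp only [Finset.coe_filter, Finset.mem_filter, Set.mem_ofPred_eq] at hp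
              simp only [Finset.coe_Ico, Set.mem_Ico]
              omega
            · rintro ⟨x, y⟩ hp ⟨x', y'⟩ hp' hxy
              simp only [Finset.coe_filter, Finset.mem_filter, Set.mem_ofPred_eq] at hp hp' hxy
              ext
              · exact hp.2.trans hp'.2.symm
              · exact hxy
        _ ≤ 2 * h := by rw [Nat.card_Ico]; omega
  rw [Finset.card_range] at this
  linarith

open Classical in
lemma card_blockRel_le {b s t : ℕ} (hb : 2 ≤ b) (hs : 1 ≤ s) (hst : 7 * s ≤ t + 1) :
    ((Finset.range (b ^ (s + t + 2)) ×ˢ (Finset.range (b ^ (3 * s)) ×ˢ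
      Finset.range (b ^ (3 * s)))).filter fun p => b ^ (s + t + 1) ≤ p.1 ∧ p.1.Coprime b ∧
        BlockRel b s t p.1 p.2.1 p.2.2).card * b ^ (2 * s) ≤ 8 * b ^ (7 * s + t + 3) := by
  set P := (Finset.range (b ^ (s + t + 2)) ×ˢ (Finset.range (b ^ (3 * s)) ×ˢ
      Finset.range (b ^ (3 * s)))).filter fun p => b ^ (s + t + 1) ≤ p.1 ∧ p.1.Coprime b ∧
        BlockRel b s t p.1 p.2.1 p.2.2 with hP
  set U := Finset.range (b ^ (3 * s)) ×ˢ Finset.range (b ^ (3 * s)) with hU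
  set near : ℕ × ℕ → Prop := fun p => p.1 < p.2 + b ^ s ∧ p.2 < p.1 + b ^ s with hnear
  have hmaps : ∀ p ∈ P, p.2 ∈ U := fun p hp => (Finset.mem_product.1 (Finset.mem_filter.1 hp).1).2
  have hfib : ∀ q ∈ U, (P.filter fun p => p.2 = q).card * b ^ (2 * s) ≤
      (if near q then b ^ (3 * s + t + 2) else 0) + 6 * b ^ (s + t + 3) := by
    rintro ⟨u, u'⟩ hq
    obtain ⟨hu, hu'⟩ := Finset.mem_product.1 hq
    simp only [Finset.mem_range] at hu hu'
    have himg : (P.filter fun p => p.2 = (u, u')).card =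
        ((P.filter fun p => p.2 = (u, u')).image Prod.fst).card := by
      symm
      apply Finset.card_image_of_injOn
      rintro ⟨x, y⟩ hp ⟨x', y'⟩ hp' hxy
      simp only [Finset.coe_filter, Set.mem_ofPred_eq] at hp hp' hxy
      exact Prod.ext hxy (hp.2.trans hp'.2.symm)
    have hmem : ∀ d ∈ (P.filter fun p => p.2 = (u, u')).image Prod.fst,
        b ^ (s + t + 1) ≤ d ∧ d < b ^ (s + t + 2) ∧ d.Coprime b ∧ BlockRel b s t d u u' := by
      intro d hd
      simp only [Finset.mem_image, Finset.mem_filter, hP, Finset.mem_product,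
        Finset.mem_range] at hd
      obtain ⟨⟨x, y, y'⟩, ⟨⟨h1, h2, h3, h4⟩, h5⟩, rfl⟩ := hd
      simp only [Prod.mk.injEq] at h5
      obtain ⟨rfl, rfl⟩ := h5
      exact ⟨h2, h1.1, h3, h4⟩
    rw [himg]
    by_cases hn : near (u, u')
    · rw [if_pos hn]
      have : ((P.filter fun p => p.2 = (u, u')).image Prod.fst).card ≤ b ^ (s + t + 2) := by
        rw [← Finset.card_range (b ^ (s + t + 2))]
        exact Finset.card_le_card fun d hd => Finset.mem_range.2 (hmem d hd).2.1
      calc _ ≤ b ^ (s + t + 2) * b ^ (2 * s) := Nat.mul_le_mul_right _ this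
        _ = b ^ (3 * s + t + 2) := by rw [← pow_add]; congr 1; ring
        _ ≤ _ := Nat.le_add_right _ _
    · rw [if_neg hn, zero_add]
      rcases le_or_gt (u' + b ^ s) u with h | h
      · exact card_blockRel_le_of_le hb hs hst u u' hu h _ hmem
      · have h' : u + b ^ s ≤ u' := by
          simp only [hnear] at hn
          omega
        refine card_blockRel_le_of_le hb hs hst u' u hu' h' _ fun d hd => ?_
        obtain ⟨h1, h2, h3, h4⟩ := hmem d hd
        exact ⟨h1, h2, h3, h4.symm⟩
  rw [Finset.card_eq_sum_card_fiberwise hmaps, Finset.sum_mul]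
  refine (Finset.sum_le_sum hfib).trans ?_
  rw [Finset.sum_add_distrib, ← Finset.sum_filter, Finset.sum_const, Finset.sum_const, smul_eq_mul,
    smul_eq_mul]
  have h1 : (U.filter near).card ≤ b ^ (3 * s) * (2 * b ^ s) := by
    convert card_near_le (b ^ (3 * s)) (b ^ s)
  have h2 : U.card = b ^ (3 * s) * b ^ (3 * s) := by
    rw [hU, Finset.card_product, Finset.card_range]
  rw [h2]
  calc _ ≤ b ^ (3 * s) * (2 * b ^ s) * b ^ (3 * s + t + 2) +
        b ^ (3 * s) * b ^ (3 * s) * (6 * b ^ (s + t + 3)) := by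
        gcongr
    _ = 2 * b ^ (7 * s + t + 2) + 6 * b ^ (7 * s + t + 3) := by ring
    _ ≤ 2 * b ^ (7 * s + t + 3) + 6 * b ^ (7 * s + t + 3) := by
        gcongr <;> omega
    _ = _ := by ring
lemma mirror_injOn {b k a a' : ℕ} (hb : 0 < b) (h : mirror b k a = mirror b k a') : a = a' := by
  have key : ∀ x, mirror b k x / b ^ k = x := by
    intro x
    rw [mirror, add_comm, Nat.add_mul_div_right _ _ (by positivity),
      Nat.div_eq_of_lt (digitRev_lt hb _ _), zero_add]
  rw [← key a, ← key a', h]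

lemma mirror_inner_eq {b j r x w w' d : ℕ} (hb : 0 < b) (hw : w < b ^ (r + 1))
    (hw' : w' < b ^ (r + 1)) (hd : b ^ (r + 1) ≤ d) (hdb : d.Coprime b)
    (h : d ^ 2 ∣ mirror b (j + r) (x * b ^ (r + 1) + w))
    (h' : d ^ 2 ∣ mirror b (j + r) (x * b ^ (r + 1) + w')) : w = w' := by
  rw [mirror_peel hb _ _ _ _ hw] at h
  rw [mirror_peel hb _ _ _ _ hw'] at h'
  have hlt : b ^ (2 * r + 1) ≤ d ^ 2 :=
    calc b ^ (2 * r + 1) ≤ b ^ ((r + 1) * 2) := Nat.pow_le_pow_right hb (by omega)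
      _ = (b ^ (r + 1)) ^ 2 := by rw [pow_mul]
      _ ≤ d ^ 2 := Nat.pow_le_pow_left hd 2
  have h1 : (x * b ^ (2 * r + 1 + j) + digitRev b j x) + b ^ j * mirror b r w ≡
      (x * b ^ (2 * r + 1 + j) + digitRev b j x) + b ^ j * mirror b r w' [MOD d ^ 2] := by
    refine ((Nat.modEq_zero_iff_dvd.2 ?_)).trans (Nat.modEq_zero_iff_dvd.2 ?_).symm
    · convert h using 1; ring
    · convert h' using 1; ring
  have h2 := Nat.ModEq.add_left_cancel' _ h1
  have h3 : mirror b r w ≡ mirror b r w' [MOD d ^ 2] :=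
    Nat.ModEq.cancel_left_of_coprime (hdb.pow 2 j) h2
  exact mirror_injOn hb (h3.eq_of_lt_of_lt ((mirror_lt hb _ _ hw).trans_le hlt)
    ((mirror_lt hb _ _ hw').trans_le hlt))

lemma blockRel_of_dvd {b s t L c u u' v w w' d : ℕ} (hb : 0 < b) (hu : u < b ^ (3 * s))
    (hu' : u' < b ^ (3 * s)) (hv : v < b ^ s) (hw : w < b ^ (t + 1)) (hw' : w' < b ^ (t + 1))
    (hdb : d.Coprime b)
    (h : d ^ 2 ∣ mirror b (L + 3 * s + (s + t))
      ((c * b ^ (3 * s) + u) * b ^ (s + t + 1) + (v * b ^ (t + 1) + w)))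
    (h' : d ^ 2 ∣ mirror b (L + 3 * s + (s + t))
      ((c * b ^ (3 * s) + u') * b ^ (s + t + 1) + (v * b ^ (t + 1) + w'))) :
    BlockRel b s t d u u' := by
  have hvw : ∀ w, w < b ^ (t + 1) → v * b ^ (t + 1) + w < b ^ (s + t + 1) := by
    intro w hw
    calc v * b ^ (t + 1) + w < (v + 1) * b ^ (t + 1) := by linarith
      _ ≤ b ^ s * b ^ (t + 1) := Nat.mul_le_mul_right _ hv
      _ = _ := by rw [← pow_add, add_assoc]
  rw [mirror_peel hb _ _ _ _ (hvw w hw), mirror_peel hb _ _ _ _ hw, digitRev_concat hb _ _ _ _ hu,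
    ← Int.natCast_dvd_natCast] at h
  rw [mirror_peel hb _ _ _ _ (hvw w' hw'), mirror_peel hb _ _ _ _ hw',
    digitRev_concat hb _ _ _ _ hu', ← Int.natCast_dvd_natCast] at h'
  have h1 := dvd_sub h h'
  have hcop : IsCoprime ((d : ℤ) ^ 2) ((b : ℤ) ^ L) := (Nat.isCoprime_iff_coprime.2 hdb).pow
  have h2 : ((d ^ 2 : ℕ) : ℤ) ∣ (b : ℤ) ^ L *
      (((u : ℤ) - u') * (b : ℤ) ^ (2 * (s + t) + 1 + 3 * s) +
        ((mirror b t w : ℤ) - mirror b t w') * (b : ℤ) ^ (4 * s) +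
        ((digitRev b (3 * s) u : ℤ) - digitRev b (3 * s) u')) := by
    refine h1.trans (dvd_of_eq ?_)
    push_cast
    ring
  rw [Nat.cast_pow] at h2
  obtain ⟨m, hm⟩ := hcop.dvd_of_dvd_mul_left h2
  refine ⟨m, _, hm, ?_⟩
  have r1 : (mirror b t w : ℤ) < (b : ℤ) ^ (2 * t + 1) := by exact_mod_cast mirror_lt hb _ _ hw
  have r2 : (mirror b t w' : ℤ) < (b : ℤ) ^ (2 * t + 1) := by exact_mod_cast mirror_lt hb _ _ hw'
  rw [abs_lt]
  constructor <;> linarith [Int.natCast_nonneg (mirror b t w), Int.natCast_nonneg (mirror b t w')]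

lemma eq_digit_blocks {b a L s t : ℕ} (hb : 0 < b) (ha : a < b ^ (L + 3 * s + (s + t) + 1)) :
    ∃ c u v w, c < b ^ L ∧ u < b ^ (3 * s) ∧ v < b ^ s ∧ w < b ^ (t + 1) ∧
      a = (c * b ^ (3 * s) + u) * b ^ (s + t + 1) + (v * b ^ (t + 1) + w) := by
  refine ⟨a / b ^ (t + 1) / b ^ s / b ^ (3 * s), a / b ^ (t + 1) / b ^ s % b ^ (3 * s),
    a / b ^ (t + 1) % b ^ s, a % b ^ (t + 1), ?_, Nat.mod_lt _ (by positivity),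
    Nat.mod_lt _ (by positivity), Nat.mod_lt _ (by positivity), ?_⟩
  · rw [Nat.div_div_eq_div_mul, Nat.div_div_eq_div_mul, Nat.div_lt_iff_lt_mul (by positivity),
      ← pow_add, ← pow_add, ← pow_add]
    convert ha using 2
    ring
  · rw [Nat.div_add_mod', add_assoc s t 1, pow_add b s (t + 1), ← mul_assoc, ← add_assoc,
      ← add_mul, Nat.div_add_mod', Nat.div_add_mod']

open Classical in
lemma card_sq_dvd_mirror_le {b s t L : ℕ} (hb : 2 ≤ b) (hs : 1 ≤ s) (hst : 7 * s ≤ t + 1) :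
    ((Finset.range (b ^ (s + t + 2)) ×ˢ Finset.range (b ^ (L + 3 * s + (s + t) + 1))).filter
      fun p => b ^ (s + t + 1) ≤ p.1 ∧ p.1.Coprime b ∧
        p.1 ^ 2 ∣ mirror b (L + 3 * s + (s + t)) p.2).card ^ 2 * b ^ s ≤
      8 * b ^ (2 * (L + 3 * s + (s + t)) + 5) := by
  have hb0 : 0 < b := by omega
  set T := (Finset.range (b ^ (s + t + 2)) ×ˢ Finset.range (b ^ (L + 3 * s + (s + t) + 1))).filter
      fun p => b ^ (s + t + 1) ≤ p.1 ∧ p.1.Coprime b ∧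
        p.1 ^ 2 ∣ mirror b (L + 3 * s + (s + t)) p.2 with hT
  have hblocks : ∀ a, ∃ c u v w, a < b ^ (L + 3 * s + (s + t) + 1) →
      c < b ^ L ∧ u < b ^ (3 * s) ∧ v < b ^ s ∧ w < b ^ (t + 1) ∧
      a = (c * b ^ (3 * s) + u) * b ^ (s + t + 1) + (v * b ^ (t + 1) + w) := by
    intro a
    by_cases ha : a < b ^ (L + 3 * s + (s + t) + 1)
    · obtain ⟨c, u, v, w, h⟩ := eq_digit_blocks hb0 ha
      exact ⟨c, u, v, w, fun _ => h⟩
    · exact ⟨0, 0, 0, 0, fun h => absurd h ha⟩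
  choose c u v w hblocks using hblocks
  have hTmem : ∀ p ∈ T, p.1 < b ^ (s + t + 2) ∧ p.2 < b ^ (L + 3 * s + (s + t) + 1) ∧
      b ^ (s + t + 1) ≤ p.1 ∧ p.1.Coprime b ∧
        p.1 ^ 2 ∣ mirror b (L + 3 * s + (s + t)) p.2 := by
    intro p hp
    simp only [hT, Finset.mem_filter, Finset.mem_product, Finset.mem_range] at hp
    exact ⟨hp.1.1, hp.1.2, hp.2⟩
  have h1 := card_sq_le_card_mul_card_fiber_pairs T
    (Finset.range (b ^ (s + t + 2)) ×ˢ (Finset.range (b ^ L) ×ˢ Finset.range (b ^ s)))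
    (fun p => (p.1, (c p.2, v p.2))) (by
      intro p hp
      obtain ⟨h1, h2, -⟩ := hTmem p hp
      obtain ⟨hc, -, hv, -⟩ := hblocks _ h2
      simp only [Finset.mem_product, Finset.mem_range]
      exact ⟨h1, hc, hv⟩)
  set P := (Finset.range (b ^ (s + t + 2)) ×ˢ (Finset.range (b ^ (3 * s)) ×ˢ
      Finset.range (b ^ (3 * s)))).filter fun p => b ^ (s + t + 1) ≤ p.1 ∧ p.1.Coprime b ∧
        BlockRel b s t p.1 p.2.1 p.2.2 with hP
  have h2 : ((T ×ˢ T).filter fun p => (p.1.1, (c p.1.2, v p.1.2)) =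
      (p.2.1, (c p.2.2, v p.2.2))).card ≤ (Finset.range (b ^ L) ×ˢ P).card := by
    refine Finset.card_le_card_of_injOn
      (fun p => (c p.1.2, (p.1.1, (u p.1.2, u p.2.2)))) ?_ ?_
    · rintro ⟨⟨d, a⟩, ⟨d', a'⟩⟩ hp
      simp only [Finset.coe_filter, Finset.mem_product, Set.mem_ofPred_eq, Prod.mk.injEq] at hp
      obtain ⟨⟨hp, hp'⟩, rfl, hcc, hvv⟩ := hp
      obtain ⟨q1, q2, q3, q4, q5⟩ := hTmem _ hp
      obtain ⟨q1', q2', q3', q4', q5'⟩ := hTmem _ hp'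
      obtain ⟨r1, r2, r3, r4, r5⟩ := hblocks a q2
      obtain ⟨r1', r2', r3', r4', r5'⟩ := hblocks a' q2'
      simp only [Finset.coe_product, Set.mem_prod, Finset.mem_coe, Finset.mem_range, hP,
        Finset.mem_filter, Finset.mem_product]
      refine ⟨r1, ⟨q1, r2, r2'⟩, q3, q4, ?_⟩
      simp only at q5 q5'
      rw [r5] at q5
      rw [r5', ← hcc, ← hvv] at q5'
      exact blockRel_of_dvd hb0 r2 r2' r3 r4 r4' q4 q5 q5'
    · have hinner : ∀ d a a', (d, a) ∈ T → (d, a') ∈ T → c a = c a' → u a = u a' → a = a' := by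
        intro d a a' hp hp' hcc huu
        obtain ⟨q1, q2, q3, q4, q5⟩ := hTmem _ hp
        obtain ⟨q1', q2', q3', q4', q5'⟩ := hTmem _ hp'
        obtain ⟨r1, r2, r3, r4, r5⟩ := hblocks a q2
        obtain ⟨r1', r2', r3', r4', r5'⟩ := hblocks a' q2'
        have hvw : ∀ v w, v < b ^ s → w < b ^ (t + 1) →
            v * b ^ (t + 1) + w < b ^ (s + t + 1) := by
          intro v w hv hw
          calc v * b ^ (t + 1) + w < (v + 1) * b ^ (t + 1) := by linarith
            _ ≤ b ^ s * b ^ (t + 1) := Nat.mul_le_mul_right _ hv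
            _ = _ := by rw [← pow_add, add_assoc]
        simp only at q5 q5'
        rw [r5] at q5
        rw [r5', ← hcc, ← huu] at q5'
        rw [r5, r5', ← hcc, ← huu,
          mirror_inner_eq hb0 (hvw _ _ r3 r4) (hvw _ _ r3' r4') q3 q4 q5 q5']
      rintro ⟨⟨d, a⟩, ⟨d', a'⟩⟩ hp ⟨⟨d₁, a₁⟩, ⟨d₁', a₁'⟩⟩ hp₁ he
      simp only [Finset.coe_filter, Finset.mem_product, Set.mem_ofPred_eq, Prod.mk.injEq]
        at hp hp₁ he
      obtain ⟨⟨hp, hp'⟩, rfl, hcc, hvv⟩ := hp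
      obtain ⟨⟨hp₁, hp₁'⟩, rfl, hcc₁, hvv₁⟩ := hp₁
      obtain ⟨e1, rfl, e3, e4⟩ := he
      rw [hinner _ _ _ hp hp₁ e1 e3,
        hinner _ _ _ hp' hp₁' (hcc.symm.trans (e1.trans hcc₁)) e4]
  have h3 := card_blockRel_le hb hs hst (t := t)
  rw [← hP] at h3
  simp only [Finset.card_product, Finset.card_range] at h1 h2
  calc T.card ^ 2 * b ^ s
      ≤ (b ^ (s + t + 2) * (b ^ L * b ^ s) * (b ^ L * P.card)) * b ^ s := by
        refine Nat.mul_le_mul_right _ (h1.trans (Nat.mul_le_mul_left _ h2))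
    _ = b ^ (s + t + 2 + 2 * L) * (P.card * b ^ (2 * s)) := by ring
    _ ≤ b ^ (s + t + 2 + 2 * L) * (8 * b ^ (7 * s + t + 3)) := Nat.mul_le_mul_left _ h3
    _ = _ := by ring

lemma mirror_mod_pow {b ℓ r a : ℕ} (hb : 0 < b) :
    mirror b (ℓ + r) a % b ^ ℓ = digitRev b ℓ (a / b ^ (r + 1)) := by
  have h := mirror_peel hb ℓ r (a / b ^ (r + 1)) (a % b ^ (r + 1)) (Nat.mod_lt _ (by positivity))
  rw [Nat.div_add_mod'] at h
  rw [h, pow_add b _ ℓ]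
  have : a / b ^ (r + 1) * (b ^ (2 * r + 1) * b ^ ℓ) + b ^ ℓ * mirror b r (a % b ^ (r + 1)) +
      digitRev b ℓ (a / b ^ (r + 1)) = digitRev b ℓ (a / b ^ (r + 1)) +
      b ^ ℓ * (a / b ^ (r + 1) * b ^ (2 * r + 1) + mirror b r (a % b ^ (r + 1))) := by ring
  rw [this, Nat.add_mul_mod_self_left, Nat.mod_eq_of_lt (digitRev_lt hb _ _)]

/-- Mirrored numbers with the same low digits also share their leading digits. -/
lemma mirror_lt_add_of_modEq {b ℓ r a a' : ℕ} (hb : 0 < b) (ha : a < b ^ (ℓ + r + 1))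
    (ha' : a' < b ^ (ℓ + r + 1)) (h : mirror b (ℓ + r) a ≡ mirror b (ℓ + r) a' [MOD b ^ ℓ]) :
    mirror b (ℓ + r) a' < mirror b (ℓ + r) a + b ^ (ℓ + 2 * r + 1) := by
  have hlt : ∀ x, x < b ^ (ℓ + r + 1) → x / b ^ (r + 1) < b ^ ℓ := by
    intro x hx
    rwa [Nat.div_lt_iff_lt_mul (by positivity), ← pow_add, ← add_assoc]
  have h1 : a / b ^ (r + 1) = a' / b ^ (r + 1) := by
    rw [Nat.ModEq, mirror_mod_pow hb, mirror_mod_pow hb] at h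
    rw [← digitRev_digitRev hb ℓ _ (hlt a ha), h, digitRev_digitRev hb ℓ _ (hlt a' ha')]
  have h2 : a' + 1 ≤ a + b ^ (r + 1) := by
    have e1 := Nat.div_add_mod' a (b ^ (r + 1))
    have e2 := Nat.div_add_mod' a' (b ^ (r + 1))
    have e3 := Nat.mod_lt a' (show 0 < b ^ (r + 1) by positivity)
    rw [h1] at e1
    linarith [Nat.zero_le (a % b ^ (r + 1))]
  have h3 := Nat.mul_le_mul_right (b ^ (ℓ + r)) h2
  have h4 := digitRev_lt hb (ℓ + r) (a' / b)
  rw [add_mul, add_mul, ← pow_add, show r + 1 + (ℓ + r) = ℓ + 2 * r + 1 by ring] at h3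
  rw [mirror, mirror]
  omega

lemma card_large_sq_dvd_mirror_le {b e k ℓ : ℕ} (hb : 2 ≤ b) (hek : e ≤ k) (hℓ : e ≤ 2 * ℓ)
    (hℓk : ℓ ≤ k) :
    ((Finset.range (b ^ (e + 1)) ×ˢ Finset.range (b ^ (k + 1))).filter
      fun p => b ^ e ≤ p.1 ∧ b ^ k ≤ p.2 ∧ p.1 ^ 2 ∣ mirror b k p.2).card ≤
      (b ^ 2 + 1) * (b ^ (2 * k + 1 - 2 * e) * b ^ ℓ) := by
  classical
  have hb0 : 0 < b := by omega
  obtain ⟨r, rfl⟩ := Nat.exists_eq_add_of_le hℓk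
  set k := ℓ + r with hk
  have hmul : ∀ p : ℕ × ℕ, p.1 ^ 2 ∣ mirror b k p.2 →
      mirror b k p.2 = p.1 ^ 2 * (mirror b k p.2 / p.1 ^ 2) :=
    fun p hp => (Nat.mul_div_cancel' hp).symm
  have h := Finset.card_le_mul_card_image_of_maps_to
    (s := (Finset.range (b ^ (e + 1)) ×ˢ Finset.range (b ^ (k + 1))).filter
      fun p => b ^ e ≤ p.1 ∧ b ^ k ≤ p.2 ∧ p.1 ^ 2 ∣ mirror b k p.2)
    (t := Finset.range (b ^ (2 * k + 1 - 2 * e)) ×ˢ Finset.range (b ^ ℓ))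
    (f := fun p => (mirror b k p.2 / p.1 ^ 2, p.1 % b ^ ℓ)) ?_ (b ^ 2 + 1) ?_
  · simpa only [Finset.card_product, Finset.card_range] using h
  · intro p hp
    simp only [Finset.mem_filter, Finset.mem_product, Finset.mem_range] at hp ⊢
    obtain ⟨⟨h1, h2⟩, h3, h4, h5⟩ := hp
    refine ⟨?_, Nat.mod_lt _ (by positivity)⟩
    apply Nat.div_lt_of_lt_mul
    calc mirror b k p.2 < b ^ (2 * k + 1) := mirror_lt hb0 _ _ h2
      _ = (b ^ e) ^ 2 * b ^ (2 * k + 1 - 2 * e) := by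
        rw [← pow_mul, ← pow_add]; congr 1; omega
      _ ≤ _ := Nat.mul_le_mul_right _ (Nat.pow_le_pow_left h3 2)
  · rintro ⟨m, c⟩ -
    set S := ((Finset.range (b ^ (e + 1)) ×ˢ Finset.range (b ^ (k + 1))).filter
      fun p => b ^ e ≤ p.1 ∧ b ^ k ≤ p.2 ∧ p.1 ^ 2 ∣ mirror b k p.2).filter
      fun p => (mirror b k p.2 / p.1 ^ 2, p.1 % b ^ ℓ) = (m, c) with hS
    have hSmem : ∀ p ∈ S, p.1 < b ^ (e + 1) ∧ p.2 < b ^ (k + 1) ∧ b ^ k ≤ p.2 ∧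
        mirror b k p.2 = p.1 ^ 2 * m ∧ p.1 % b ^ ℓ = c := by
      intro p hp
      simp only [hS, Finset.mem_filter, Finset.mem_product, Finset.mem_range,
        Prod.mk.injEq] at hp
      obtain ⟨⟨⟨h1, h2⟩, h3, h4, h5⟩, h6, h7⟩ := hp
      exact ⟨h1, h2, h4, by rw [← h6]; exact hmul p h5, h7⟩
    have hinj : (S.image Prod.fst).card = S.card := by
      apply Finset.card_image_of_injOn
      intro p hp p' hp' he
      obtain ⟨-, -, -, h1, -⟩ := hSmem p hp
      obtain ⟨-, -, -, h2, -⟩ := hSmem p' hp'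
      refine Prod.ext he (mirror_injOn hb0 (k := k) ?_)
      rw [h1, h2, he]
    rw [← hinj]
    have hcard := card_le_of_congruent_of_close (S.image Prod.fst) (b ^ ℓ) (b ^ (e + 2 - ℓ)) ?_
    · refine hcard.trans (Nat.succ_le_succ ?_)
      rw [Nat.div_le_iff_le_mul_add_pred (by positivity)]
      refine le_trans ?_ (Nat.le_add_right _ _)
      rw [← pow_add]
      exact Nat.pow_le_pow_right hb0 (by omega)
    · simp only [Finset.mem_image]
      rintro d ⟨p, hp, rfl⟩ d' ⟨p', hp', rfl⟩ hdd
      obtain ⟨h1, h2, h3, h4, h5⟩ := hSmem p hp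
      obtain ⟨h1', h2', h3', h4', h5'⟩ := hSmem p' hp'
      have hmod : p.1 ≡ p'.1 [MOD b ^ ℓ] := h5.trans h5'.symm
      refine ⟨hmod, ?_⟩
      have hn : mirror b k p.2 ≡ mirror b k p'.2 [MOD b ^ ℓ] := by
        rw [h4, h4']
        exact (hmod.pow 2).mul_right m
      have hclose := mirror_lt_add_of_modEq hb0 h2 h2' hn
      rw [← hk, h4, h4'] at hclose
      have hge : b ^ (2 * k) ≤ p.1 ^ 2 * m := by
        have := Nat.mul_le_mul_right (b ^ k) h3
        rw [← h4, mirror, two_mul, pow_add]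
        omega
      obtain ⟨x, hx⟩ := Nat.exists_eq_add_of_le hdd
      rw [hx] at hclose ⊢
      rw [Nat.add_sub_cancel_left]
      have h6 : x * p.1 * m < b ^ (ℓ + 2 * r + 1) := by
        nlinarith [Nat.zero_le (x * x * m), Nat.zero_le (x * p.1 * m)]
      have h7 : x * b ^ (2 * k) ≤ b ^ (ℓ + 2 * r + 1) * b ^ (e + 1) :=
        calc x * b ^ (2 * k) ≤ x * (p.1 ^ 2 * m) := Nat.mul_le_mul_left _ hge
          _ = x * p.1 * m * p.1 := by ring
          _ ≤ _ := Nat.mul_le_mul h6.le h1.le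
      have h8 : x * b ^ ℓ ≤ b ^ (e + 2) := by
        refine Nat.le_of_mul_le_mul_right (c := b ^ (ℓ + 2 * r)) ?_ (by positivity)
        calc x * b ^ ℓ * b ^ (ℓ + 2 * r) = x * b ^ (2 * k) := by rw [hk]; ring
          _ ≤ _ := h7
          _ = _ := by ring
      rcases le_or_gt ℓ (e + 2) with hle | hgt
      · refine Nat.le_of_mul_le_mul_right (c := b ^ ℓ) ?_ (by positivity)
        rwa [← pow_add, Nat.sub_add_cancel hle]
      · have : x * b ^ ℓ < 1 * b ^ ℓ := by
          rw [one_mul]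
          exact h8.trans_lt (Nat.pow_lt_pow_right (by omega) hgt)
        have := Nat.lt_of_mul_lt_mul_right this
        omega

/-- The residue modulo `q` contributed to a palindrome by a block `x` of `j` digits and its mirror
image, when `b ^ j ≡ 1 [MOD q]`. -/
def palResidue (b q j x : ℕ) : ZMod q := b * x + digitRev b j x

/-- The number of blocks of `j` digits contributing the residue `r`. -/
def palCount (b q j : ℕ) (r : ZMod q) : ℕ :=
  ((Finset.range (b ^ j)).filter fun y => palResidue b q j y = r).card

lemma palResidue_concat {b q i j x y : ℕ} (hb : 0 < b) (hi : (b : ZMod q) ^ i = 1)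
    (hj : (b : ZMod q) ^ j = 1) (hy : y < b ^ j) :
    palResidue b q (i + j) (x * b ^ j + y) = palResidue b q i x + palResidue b q j y := by
  simp only [palResidue, digitRev_concat hb i j x y hy]
  push_cast
  rw [hi, hj]
  ring

lemma digitRev_zero (b j : ℕ) : digitRev b j 0 = 0 := by
  induction j with
  | zero => rfl
  | succ j ih => simp [digitRev, ih]

lemma digitRev_pow {b : ℕ} (hb : 2 ≤ b) (j : ℕ) : digitRev b (j + 1) (b ^ j) = 1 := by
  have h := digitRev_concat (show 0 < b by omega) 1 j 1 0 (by positivity)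
  rw [digitRev_zero, one_mul, add_zero, add_comm 1 j] at h
  rw [h]
  simp [digitRev, Nat.mod_eq_of_lt hb]

lemma exists_palResidue_eq_two_mul {b q g : ℕ} (hb : 2 ≤ b)
    (hg : (b : ZMod q) ^ (g + 1) = 1) (Q t : ℕ) (ht : t ≤ Q) :
    ∃ x < b ^ ((g + 1) * Q), palResidue b q ((g + 1) * Q) x = 2 * (t : ZMod q) := by
  have hb0 : 0 < b := by omega
  induction Q generalizing t with
  | zero =>
    obtain rfl : t = 0 := by omega
    exact ⟨0, by simp, by simp [palResidue, digitRev_zero]⟩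
  | succ Q ih =>
    have hQ : (b : ZMod q) ^ ((g + 1) * Q) = 1 := by rw [pow_mul, hg, one_pow]
    rcases Nat.eq_zero_or_pos t with rfl | ht0
    · exact ⟨0, by positivity, by simp [palResidue, digitRev_zero]⟩
    · obtain ⟨y, hy, hy2⟩ := ih (t - 1) (by omega)
      refine ⟨b ^ g * b ^ ((g + 1) * Q) + y, ?_, ?_⟩
      · have h1 : (b ^ g + 1) * b ^ ((g + 1) * Q) ≤ b ^ (g + 1) * b ^ ((g + 1) * Q) :=
          Nat.mul_le_mul_right _ (Nat.pow_lt_pow_right (by omega) (by omega))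
        rw [← pow_add, show g + 1 + (g + 1) * Q = (g + 1) * (Q + 1) by ring] at h1
        linarith
      · rw [show (g + 1) * (Q + 1) = g + 1 + (g + 1) * Q by ring,
          palResidue_concat hb0 hg hQ hy, hy2, palResidue, digitRev_pow hb, Nat.cast_pow,
          ← pow_succ', hg, Nat.cast_sub ht0]
        push_cast
        ring

lemma exists_palResidue_eq {b q g Q : ℕ} (hb : 2 ≤ b) (hq : Odd q) (hqQ : q ≤ Q)
    (hg : (b : ZMod q) ^ (g + 1) = 1) (r : ZMod q) :
    ∃ x < b ^ ((g + 1) * Q), palResidue b q ((g + 1) * Q) x = r := by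
  have : NeZero q := ⟨by rintro rfl; simp at hq⟩
  have h2 : IsUnit ((2 : ℕ) : ZMod q) :=
    (ZMod.isUnit_iff_coprime 2 q).2 (Nat.coprime_two_left.2 hq)
  obtain ⟨c, hc⟩ := h2.exists_right_inv
  obtain ⟨x, hx, hx'⟩ := exists_palResidue_eq_two_mul hb hg Q (c * r).val
    ((ZMod.val_lt _).le.trans hqQ)
  refine ⟨x, hx, ?_⟩
  rw [hx', ZMod.natCast_val, ZMod.cast_id', id, ← mul_assoc]
  push_cast at hc
  rw [hc, one_mul]

lemma card_le_sum_palCount {b q i j : ℕ} (hb : 0 < b) (hi : (b : ZMod q) ^ i = 1)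
    (hj : (b : ZMod q) ^ j = 1) (A S : Finset ℕ) (r : ZMod q)
    (hS : ∀ z ∈ S, z / b ^ j ∈ A ∧ palResidue b q (i + j) z = r) :
    S.card ≤ ∑ x ∈ A, palCount b q j (r - palResidue b q i x) := by
  rw [Finset.card_eq_sum_card_fiberwise (f := fun z => z / b ^ j) fun z hz => (hS z hz).1]
  refine Finset.sum_le_sum fun x _ => ?_
  refine Finset.card_le_card_of_injOn (fun z => z % b ^ j) ?_ ?_
  · intro z hz
    simp only [Finset.coe_filter, Set.mem_ofPred_eq] at hz
    have h := (hS z hz.1).2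
    have hlt := Nat.mod_lt z (show 0 < b ^ j by positivity)
    rw [← Nat.div_add_mod' z (b ^ j), palResidue_concat hb hi hj hlt, hz.2] at h
    simp only [Finset.coe_filter, Set.mem_ofPred_eq, Finset.mem_range]
    exact ⟨hlt, by rw [← h]; ring⟩
  · intro z hz z' hz' h
    simp only [Finset.coe_filter, Set.mem_ofPred_eq] at hz hz'
    rw [← Nat.div_add_mod' z (b ^ j), ← Nat.div_add_mod' z' (b ^ j), hz.2, hz'.2]
    exact congrArg _ h

lemma sum_palCount (b q j : ℕ) [NeZero q] : ∑ r : ZMod q, palCount b q j r = b ^ j := by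
  have := Finset.card_eq_sum_card_fiberwise (s := Finset.range (b ^ j))
    (t := (Finset.univ : Finset (ZMod q))) (f := palResidue b q j) (by simp)
  rw [Finset.card_range] at this
  exact this.symm

lemma palCount_le {b q g : ℕ} (hb : 2 ≤ b) (hq : 0 < q) (hg : (b : ZMod q) ^ g = 1)
    (hsurj : ∀ r : ZMod q, ∃ x < b ^ g, palResidue b q g x = r) (m : ℕ) (r : ZMod q) :
    q ≤ b ^ g ∧ (palCount b q (g * m) r : ℝ) ≤
      ((b : ℝ) ^ g) ^ m * (1 / q + (1 - q / (b : ℝ) ^ g) ^ m) := by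
  have : NeZero q := ⟨hq.ne'⟩
  have hb0 : 0 < b := by omega
  choose f hf hf' using hsurj
  have hinj : Function.Injective f := fun r r' h => by rw [← hf' r, ← hf' r', h]
  have himg : (Finset.univ.image f) ⊆ Finset.range (b ^ g) := by
    intro x hx
    obtain ⟨r, -, rfl⟩ := Finset.mem_image.1 hx
    exact Finset.mem_range.2 (hf r)
  have hcardimg : (Finset.univ.image f).card = q := by
    rw [Finset.card_image_of_injective _ hinj, Finset.card_univ, ZMod.card]
  have hqX : q ≤ b ^ g := by
    rw [← hcardimg, ← Finset.card_range (b ^ g)]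
    exact Finset.card_le_card himg
  refine ⟨hqX, ?_⟩
  have hX : (0 : ℝ) < (b : ℝ) ^ g := by positivity
  have hq' : (0 : ℝ) < q := by exact_mod_cast hq
  induction m generalizing r with
  | zero =>
    have h1 : palCount b q (g * 0) r ≤ 1 := by
      refine (Finset.card_filter_le _ _).trans ?_
      simp
    have h2 : (palCount b q (g * 0) r : ℝ) ≤ 1 := by exact_mod_cast h1
    simp only [pow_zero, one_mul]
    have : 0 < 1 / (q : ℝ) := by positivity
    linarith
  | succ m ih =>
    have hgm : (b : ZMod q) ^ (g * m) = 1 := by rw [pow_mul, hg, one_pow]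
    have h1 := card_le_sum_palCount hb0 hg hgm (Finset.range (b ^ g))
      ((Finset.range (b ^ (g * (m + 1)))).filter fun y => palResidue b q (g * (m + 1)) y = r) r
      (by
        intro z hz
        simp only [Finset.mem_filter, Finset.mem_range] at hz ⊢
        rw [show g * (m + 1) = g + g * m by ring] at hz
        refine ⟨?_, hz.2⟩
        rw [Nat.div_lt_iff_lt_mul (by positivity), ← pow_add]
        exact hz.1)
    rw [← Finset.sum_sdiff himg, Finset.sum_image hinj.injOn] at h1
    simp only [hf'] at h1
    have h2 : ∑ s : ZMod q, palCount b q (g * m) (r - s) = b ^ (g * m) := by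
      rw [← sum_palCount b q (g * m)]
      exact Equiv.sum_comp (Equiv.subLeft r) (palCount b q (g * m))
    rw [h2] at h1
    set M := ((b : ℝ) ^ g) ^ m * (1 / q + (1 - q / (b : ℝ) ^ g) ^ m) with hM
    have h3 : ((∑ x ∈ Finset.range (b ^ g) \ Finset.univ.image f,
        palCount b q (g * m) (r - palResidue b q g x) : ℕ) : ℝ) ≤ ((b : ℝ) ^ g - q) * M := by
      rw [Nat.cast_sum]
      refine (Finset.sum_le_card_nsmul _ _ M fun x _ => ih _).trans_eq ?_
      rw [Finset.card_sdiff_of_subset himg, hcardimg, Finset.card_range, nsmul_eq_mul,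
        Nat.cast_sub hqX, Nat.cast_pow]
    have h4 : (palCount b q (g * (m + 1)) r : ℝ) ≤ ((b : ℝ) ^ g - q) * M + (b : ℝ) ^ (g * m) := by
      have : (palCount b q (g * (m + 1)) r : ℝ) ≤ _ := Nat.cast_le.2 h1
      rw [Nat.cast_add, Nat.cast_pow] at this
      linarith
    refine h4.trans_eq ?_
    rw [hM, pow_mul, pow_succ (1 - (q : ℝ) / (b : ℝ) ^ g) m]
    field_simp
    ring

lemma card_dvd_mirror_le {b q g m : ℕ} (hb : 2 ≤ b) (hq : 0 < q) (hg0 : 0 < g)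
    (hg : (b : ZMod q) ^ g = 1)
    (hsurj : ∀ r : ZMod q, ∃ x < b ^ g, palResidue b q g x = r) :
    (((Finset.Ico (b ^ (g * (m + 1) - 1)) (2 * b ^ (g * (m + 1) - 1))).filter
      fun a => q ∣ mirror b (g * (m + 1)) (a * b + 1)).card : ℝ) ≤
      (b : ℝ) ^ (g * (m + 1) - 1) * (1 / q + (1 - q / (b : ℝ) ^ g) ^ m) := by
  have hb0 : 0 < b := by omega
  have hgm : (b : ZMod q) ^ (g * m) = 1 := by rw [pow_mul, hg, one_pow]
  obtain ⟨h, rfl⟩ : ∃ h, g = h + 1 := ⟨g - 1, by omega⟩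
  have he : (h + 1) * (m + 1) - 1 = h + (h + 1) * m := by
    rw [show (h + 1) * (m + 1) = h + (h + 1) * m + 1 by ring, Nat.add_sub_cancel]
  have he' : (h + 1) * (m + 1) = h + 1 + (h + 1) * m := by ring
  have h1 := card_le_sum_palCount hb0 hg hgm (Finset.Ico (b ^ h) (2 * b ^ h))
      ((Finset.Ico (b ^ ((h + 1) * (m + 1) - 1)) (2 * b ^ ((h + 1) * (m + 1) - 1))).filter
      fun a => q ∣ mirror b ((h + 1) * (m + 1)) (a * b + 1)) (-1) (by
    intro z hz
    simp only [Finset.mem_filter, Finset.mem_Ico] at hz ⊢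
    rw [he, pow_add, ← mul_assoc] at hz
    refine ⟨⟨?_, ?_⟩, ?_⟩
    · rw [Nat.le_div_iff_mul_le (by positivity)]
      exact hz.1.1
    · rw [Nat.div_lt_iff_lt_mul (by positivity)]
      exact hz.1.2
    · have h2 := hz.2
      rw [← ZMod.natCast_eq_zero_iff, mirror, he'] at h2
      have h3 : (z * b + 1) / b = z := by
        rw [add_comm, Nat.add_mul_div_right _ _ hb0, Nat.div_eq_of_lt hb, zero_add]
      rw [h3] at h2
      push_cast at h2
      rw [pow_add, hgm, hg] at h2
      rw [palResidue]
      linear_combination h2)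
  have h2 : ((∑ x ∈ Finset.Ico (b ^ h) (2 * b ^ h),
      palCount b q ((h + 1) * m) (-1 - palResidue b q (h + 1) x) : ℕ) : ℝ) ≤
      (b : ℝ) ^ h * (((b : ℝ) ^ (h + 1)) ^ m * (1 / q + (1 - q / (b : ℝ) ^ (h + 1)) ^ m)) := by
    rw [Nat.cast_sum]
    refine (Finset.sum_le_card_nsmul _ _ _ fun x _ =>
      (palCount_le hb hq hg hsurj m _).2).trans_eq ?_
    rw [Nat.card_Ico, nsmul_eq_mul, two_mul, Nat.add_sub_cancel, Nat.cast_pow]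
  refine (Nat.cast_le.2 h1).trans (h2.trans_eq ?_)
  rw [he, pow_add _ h ((h + 1) * m), pow_mul, mul_assoc]

lemma sum_inv_sq_odd_le (D : ℕ) (S : Finset ℕ) (hS : ∀ d ∈ S, Odd d ∧ 3 ≤ d ∧ d < D) :
    ∑ d ∈ S, 1 / ((d ^ 2 : ℕ) : ℝ) ≤ 1 / 4 := by
  have hsub : S ⊆ (Finset.range D).image fun i => 2 * i + 3 := by
    intro d hd
    obtain ⟨⟨i, rfl⟩, h3, hD⟩ := hS d hd
    exact Finset.mem_image.2 ⟨i - 1, Finset.mem_range.2 (by omega), by omega⟩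
  have hle : ∀ n : ℕ, ∑ i ∈ Finset.range n, 1 / (((2 * i + 3) ^ 2 : ℕ) : ℝ) ≤
      1 / 4 - 1 / (4 * (n + 1)) := by
    intro n
    induction n with
    | zero => norm_num
    | succ n ih =>
      rw [Finset.sum_range_succ]
      have h1 : 1 / (((2 * n + 3) ^ 2 : ℕ) : ℝ) ≤ 1 / (4 * (n + 1)) - 1 / (4 * (n + 1 + 1)) := by
        rw [div_sub_div _ _ (by positivity) (by positivity),
          div_le_div_iff₀ (by positivity) (by positivity)]
        push_cast
        nlinarith
      push_cast at h1 ⊢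
      push_cast at ih
      linarith
  refine (Finset.sum_le_sum_of_subset_of_nonneg hsub fun _ _ _ => by positivity).trans ?_
  rw [Finset.sum_image fun i _ j _ h => by simpa using h]
  refine (hle D).trans ?_
  have : (0 : ℝ) < 1 / (4 * (D + 1)) := by positivity
  linarith

open Filter Topology in
lemma exists_eventually_sum_card_dvd_mirror_le {b : ℕ} (hb : 2 ≤ b) (D : ℕ) :
    ∃ g > 0, ∀ᶠ m in atTop, ((∑ d ∈ (Finset.range D).filter fun d => Odd d ∧ 3 ≤ d ∧ d.Coprime b,
      ((Finset.Ico (b ^ (g * (m + 1) - 1)) (2 * b ^ (g * (m + 1) - 1))).filter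
        fun a => d ^ 2 ∣ mirror b (g * (m + 1)) (a * b + 1)).card : ℕ) : ℝ) ≤
      3 / 8 * (b : ℝ) ^ (g * (m + 1) - 1) := by
  set S := (Finset.range D).filter fun d => Odd d ∧ 3 ≤ d ∧ d.Coprime b with hS
  have hSmem : ∀ d ∈ S, d < D ∧ Odd d ∧ 3 ≤ d ∧ d.Coprime b := by
    intro d hd
    simpa [hS] using hd
  set Q := D ^ 2 + 1 with hQ
  obtain ⟨h, hh⟩ : ∃ h, h + 1 = Q.factorial :=
    ⟨Q.factorial - 1, Nat.sub_add_cancel (Nat.factorial_pos Q)⟩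
  set g := (h + 1) * Q with hg
  have hg0 : 0 < g := by positivity
  have hdq : ∀ d ∈ S, 0 < d ^ 2 ∧ (b : ZMod (d ^ 2)) ^ (h + 1) = 1 ∧
      ∀ r : ZMod (d ^ 2), ∃ x < b ^ g, palResidue b (d ^ 2) g x = r := by
    intro d hd
    obtain ⟨h1, h2, h3, h4⟩ := hSmem d hd
    have hpos : 0 < d ^ 2 := by positivity
    have hqQ : d ^ 2 ≤ Q := (Nat.pow_le_pow_left h1.le 2).trans (Nat.le_succ _)
    have hone : (b : ZMod (d ^ 2)) ^ (h + 1) = 1 := by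
      rw [hh]
      obtain ⟨c, hc⟩ := Nat.dvd_factorial (Nat.totient_pos.2 hpos)
        ((Nat.totient_le _).trans hqQ)
      have := Nat.ModEq.pow_totient (h4.symm.pow_right 2)
      rw [← ZMod.natCast_eq_natCast_iff] at this
      push_cast at this
      rw [hc, pow_mul, this, one_pow]
    exact ⟨hpos, hone, exists_palResidue_eq hb h2.pow hqQ hone⟩
  refine ⟨g, hg0, ?_⟩
  have hlim : Tendsto (fun m : ℕ => ∑ d ∈ S,
      (1 / ((d ^ 2 : ℕ) : ℝ) + (1 - ((d ^ 2 : ℕ) : ℝ) / (b : ℝ) ^ g) ^ m)) atTop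
      (𝓝 (∑ d ∈ S, (1 / ((d ^ 2 : ℕ) : ℝ) + 0))) := by
    refine tendsto_finsetSum _ fun d hd => tendsto_const_nhds.add ?_
    obtain ⟨h1, h2, h3⟩ := hdq d hd
    have hX : (0 : ℝ) < (b : ℝ) ^ g := by positivity
    have h4 : ((d ^ 2 : ℕ) : ℝ) ≤ (b : ℝ) ^ g := by
      exact_mod_cast (palCount_le hb h1 (by rw [hg, pow_mul, h2, one_pow]) h3 0 0).1
    have h5 : (0 : ℝ) < ((d ^ 2 : ℕ) : ℝ) := by exact_mod_cast h1
    refine tendsto_pow_atTop_nhds_zero_of_lt_one ?_ ?_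
    · rw [sub_nonneg, div_le_one hX]
      exact h4
    · have := div_pos h5 hX
      linarith
  have hlt : ∑ d ∈ S, (1 / ((d ^ 2 : ℕ) : ℝ) + 0) < 3 / 8 := by
    simp only [add_zero]
    refine (sum_inv_sq_odd_le D S fun d hd => ?_).trans_lt (by norm_num)
    obtain ⟨h1, h2, h3, -⟩ := hSmem d hd
    exact ⟨h2, h3, h1⟩
  filter_upwards [hlim.eventually_le_const hlt] with m hm
  rw [Nat.cast_sum]
  calc _ ≤ ∑ d ∈ S, (b : ℝ) ^ (g * (m + 1) - 1) *
        (1 / ((d ^ 2 : ℕ) : ℝ) + (1 - ((d ^ 2 : ℕ) : ℝ) / (b : ℝ) ^ g) ^ m) := by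
        refine Finset.sum_le_sum fun d hd => ?_
        obtain ⟨h1, h2, h3⟩ := hdq d hd
        exact card_dvd_mirror_le hb h1 hg0 (by rw [hg, pow_mul, h2, one_pow]) h3
    _ ≤ _ := by
      rw [← Finset.mul_sum, mul_comm]
      exact mul_le_mul_of_nonneg_right hm (by positivity)

lemma three_div_four_pow_le (e : ℕ) : (3 / 4 : ℝ) ^ (e / 8) ≤ 2 * (97 / 100) ^ e := by
  have h1 : (3 / 4 : ℝ) ^ (e / 8) ≤ (97 / 100) ^ (8 * (e / 8)) := by
    rw [pow_mul]
    exact pow_le_pow_left₀ (by norm_num) (by norm_num) _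
  have h2 : (97 / 100 : ℝ) ^ (8 * (e / 8) + 7) ≤ (97 / 100) ^ e :=
    pow_le_pow_of_le_one (by norm_num) (by norm_num) (by omega)
  rw [pow_add] at h2
  have h3 : (1 / 2 : ℝ) ≤ (97 / 100) ^ 7 := by norm_num
  have h4 : (0 : ℝ) ≤ (97 / 100) ^ (8 * (e / 8)) := by positivity
  nlinarith

/-- The palindrome `mirror b k a` has a square divisor `d²` with `b ^ e ≤ d < b ^ (e + 1)`. -/
def HasSquareDivisor (b k e a : ℕ) : Prop :=
  ∃ d, b ^ e ≤ d ∧ d < b ^ (e + 1) ∧ d.Coprime b ∧ d ^ 2 ∣ mirror b k a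

open Classical in
lemma card_hasSquareDivisor_le_of_le {b k e : ℕ} (hb : 2 ≤ b) (he : 8 ≤ e)
    (hek : 11 * e ≤ 8 * (k + 1)) :
    (((Finset.range (b ^ (k + 1))).filter fun a => HasSquareDivisor b k e a).card : ℝ) ≤
      6 * (b : ℝ) ^ 3 * (b : ℝ) ^ k * (97 / 100) ^ e := by
  set s := e / 8 with hs
  obtain ⟨t, ht⟩ : ∃ t, s + t + 1 = e := ⟨e - 1 - s, by omega⟩
  obtain ⟨L, hL⟩ : ∃ L, L + 3 * s + (s + t) = k := ⟨k + 1 - e - 3 * s, by omega⟩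
  have h := card_sq_dvd_mirror_le hb (s := s) (t := t) (L := L) (by omega) (by omega)
  rw [hL, show s + t + 2 = e + 1 by omega, ht] at h
  set T := (Finset.range (b ^ (e + 1)) ×ˢ Finset.range (b ^ (k + 1))).filter
      fun p => b ^ e ≤ p.1 ∧ p.1.Coprime b ∧ p.1 ^ 2 ∣ mirror b k p.2 with hT
  have hle : ((Finset.range (b ^ (k + 1))).filter fun a => HasSquareDivisor b k e a).card ≤
      T.card := by
    refine le_trans (Finset.card_le_card ?_) (Finset.card_image_le (f := Prod.snd))
    intro a ha
    obtain ⟨ha, d, h1, h2, h3, h4⟩ := Finset.mem_filter.1 ha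
    refine Finset.mem_image.2 ⟨(d, a), ?_, rfl⟩
    simp only [hT, Finset.mem_filter, Finset.mem_product, Finset.mem_range]
    exact ⟨⟨h2, Finset.mem_range.1 ha⟩, h1, h3, h4⟩
  have hle' : (((Finset.range (b ^ (k + 1))).filter fun a => HasSquareDivisor b k e a).card : ℝ) ≤
      T.card := by exact_mod_cast hle
  have hb' : (2 : ℝ) ≤ b := by exact_mod_cast hb
  have hR : (T.card : ℝ) ^ 2 * (b : ℝ) ^ s ≤ 8 * (b : ℝ) ^ (2 * k + 5) := by exact_mod_cast h
  have h2s : (2 : ℝ) ^ s ≤ (b : ℝ) ^ s := pow_le_pow_left₀ (by norm_num) hb' s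
  have hT2 : (T.card : ℝ) ≤ 3 * (b : ℝ) ^ 3 * (b : ℝ) ^ k * (3 / 4) ^ s := by
    refine le_of_sq_le_sq ?_ (by positivity)
    have h3 : (T.card : ℝ) ^ 2 * 2 ^ s ≤ (3 * (b : ℝ) ^ 3 * (b : ℝ) ^ k) ^ 2 :=
      calc (T.card : ℝ) ^ 2 * 2 ^ s ≤ (T.card : ℝ) ^ 2 * (b : ℝ) ^ s := by gcongr
        _ ≤ 8 * (b : ℝ) ^ (2 * k + 5) := hR
        _ ≤ 9 * (b : ℝ) ^ (2 * k + 6) := by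
          have : (b : ℝ) ^ (2 * k + 5) ≤ (b : ℝ) ^ (2 * k + 6) :=
            pow_le_pow_right₀ (by linarith) (by omega)
          have h0 : (0 : ℝ) ≤ (b : ℝ) ^ (2 * k + 5) := by positivity
          linarith
        _ = _ := by ring
    have h4 : (1 / 2 : ℝ) ^ s ≤ ((3 / 4) ^ s) ^ 2 := by
      rw [← pow_mul, mul_comm, pow_mul]
      exact pow_le_pow_left₀ (by norm_num) (by norm_num) s
    calc (T.card : ℝ) ^ 2 = (T.card : ℝ) ^ 2 * 2 ^ s * (1 / 2) ^ s := by
          rw [mul_assoc, ← mul_pow]; norm_num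
      _ ≤ (3 * (b : ℝ) ^ 3 * (b : ℝ) ^ k) ^ 2 * ((3 / 4) ^ s) ^ 2 :=
          mul_le_mul h3 h4 (by positivity) (by positivity)
      _ = _ := by rw [← mul_pow]
  have h5 := three_div_four_pow_le e
  rw [← hs] at h5
  calc _ ≤ (T.card : ℝ) := hle'
    _ ≤ _ := hT2
    _ ≤ 3 * (b : ℝ) ^ 3 * (b : ℝ) ^ k * (2 * (97 / 100) ^ e) := by gcongr
    _ = _ := by ring

open Classical in
lemma card_hasSquareDivisor_mul_le {b k e : ℕ} (hb : 2 ≤ b) (hek : e ≤ k)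
    (hek' : 8 * (k + 1) < 11 * e) :
    ((Finset.Ico (b ^ k) (b ^ (k + 1))).filter fun a => HasSquareDivisor b k e a).card *
      b ^ (k / 11) ≤ (b ^ 2 + 1) * b ^ (k + 1) := by
  have h := card_large_sq_dvd_mirror_le hb hek (ℓ := (e + 1) / 2) (by omega) (by omega)
  have hle : ((Finset.Ico (b ^ k) (b ^ (k + 1))).filter fun a => HasSquareDivisor b k e a).card ≤
      (b ^ 2 + 1) * (b ^ (2 * k + 1 - 2 * e) * b ^ ((e + 1) / 2)) := by
    refine le_trans (le_trans (Finset.card_le_card ?_) (Finset.card_image_le (f := Prod.snd))) h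
    intro a ha
    obtain ⟨ha, d, h1, h2, h3, h4⟩ := Finset.mem_filter.1 ha
    refine Finset.mem_image.2 ⟨(d, a), ?_, rfl⟩
    rw [Finset.mem_Ico] at ha
    simp only [Finset.mem_filter, Finset.mem_product, Finset.mem_range]
    exact ⟨⟨h2, ha.2⟩, h1, ha.1, h4⟩
  refine (Nat.mul_le_mul_right _ hle).trans ?_
  rw [mul_assoc, ← pow_add, ← pow_add]
  exact Nat.mul_le_mul_left _ (Nat.pow_le_pow_right (by omega) (by omega))

lemma digitRev_modEq_two {b : ℕ} (hb : Odd b) (j u : ℕ) (hu : u < b ^ j) :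
    digitRev b j u ≡ u [MOD 2] := by
  have hb0 : 0 < b := hb.pos
  have hb1 : b ≡ 1 [MOD 2] := Nat.odd_iff.1 hb
  induction j generalizing u with
  | zero =>
    obtain rfl : u = 0 := by simpa using hu
    rfl
  | succ j ih =>
    have hu' : u / b < b ^ j := by
      rw [Nat.div_lt_iff_lt_mul hb0]
      simpa [pow_succ] using hu
    have h1 : digitRev b (j + 1) u ≡ u % b * 1 ^ j + u / b * 1 [MOD 2] := by
      rw [digitRev, mul_one]
      exact ((hb1.pow j).mul_left _).add (ih _ hu')
    have h2 : u % b * 1 ^ j + u / b * 1 ≡ u % b + u / b * b [MOD 2] := by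
      rw [one_pow, mul_one]
      exact (hb1.symm.mul_left _).add_left _
    refine (h1.trans h2).trans ?_
    rw [add_comm, Nat.div_add_mod']

lemma mirror_modEq_one {b k a : ℕ} (hb : 2 ≤ b) (hk : 1 ≤ k) (ha : b ^ k ≤ a)
    (ha' : a < 2 * b ^ k) : mirror b k a ≡ 1 [MOD b] := by
  obtain ⟨r, rfl⟩ : ∃ r, k = 1 + r := ⟨k - 1, by omega⟩
  obtain ⟨w, rfl⟩ := Nat.exists_eq_add_of_le ha
  have h := mirror_peel (show 0 < b by omega) 1 r 1 w (by rw [add_comm r 1]; omega)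
  rw [one_mul, add_comm r 1] at h
  rw [h]
  have h1 : digitRev b 1 1 = 1 := by simp [digitRev, Nat.mod_eq_of_lt hb]
  rw [h1, one_mul, pow_one, pow_succ]
  have : b ^ (2 * r + 1) * b + b * mirror b r w + 1 =
      1 + b * (b ^ (2 * r + 1) + mirror b r w) := by ring
  rw [this]
  exact Nat.add_mul_mod_self_left _ _ _

lemma odd_mirror {b k a : ℕ} (hb : 2 ≤ b) (hk : 1 ≤ k) (ha : b ^ (k - 1) ≤ a)
    (ha' : a < 2 * b ^ (k - 1)) :
    Odd (mirror b k (a * b + 1)) ∧ mirror b k (a * b + 1) ≡ 1 [MOD b] ∧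
      b ^ k ≤ a * b + 1 ∧ a * b + 1 < b ^ (k + 1) := by
  obtain ⟨r, rfl⟩ : ∃ r, k = r + 1 := ⟨k - 1, by omega⟩
  rw [Nat.add_sub_cancel] at ha ha'
  have hb0 : 0 < b := by omega
  have h1 : b ^ (r + 1) ≤ a * b := by rw [pow_succ]; exact Nat.mul_le_mul_right b ha
  have h2 : (a + 1) * b ≤ 2 * b ^ (r + 1) := by
    rw [pow_succ, ← mul_assoc]; exact Nat.mul_le_mul_right b ha'
  have h3 : 2 * b ^ (r + 1) ≤ b ^ (r + 1 + 1) := by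
    rw [pow_succ b (r + 1), mul_comm]; exact Nat.mul_le_mul_left _ hb
  have h4 : (a + 1) * b = a * b + b := by ring
  have hmod := mirror_modEq_one hb hk (a := a * b + 1) (by omega) (by omega)
  refine ⟨?_, hmod, by omega, by omega⟩
  rcases Nat.even_or_odd b with he | ho
  · exact Nat.odd_iff.2 (hmod.of_dvd he.two_dvd)
  · have e1 : (a * b + 1) / b = a := by
      rw [add_comm, Nat.add_mul_div_right _ _ hb0, Nat.div_eq_of_lt hb, zero_add]
    have e2 : a < b ^ (r + 1) := by
      rw [pow_succ, mul_comm]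
      exact ha'.trans_le (Nat.mul_le_mul_right _ hb)
    have e3 := digitRev_modEq_two ho (r + 1) a e2
    have e4 : b ≡ 1 [MOD 2] := Nat.odd_iff.1 ho
    have e5 : mirror b (r + 1) (a * b + 1) ≡ (a * 1 + 1) * 1 ^ (r + 1) + a [MOD 2] := by
      rw [mirror, e1]
      exact (((e4.mul_left a).add_right 1).mul (e4.pow _)).add e3
    rw [Nat.odd_iff]
    rw [one_pow, Nat.ModEq] at e5
    omega

open Classical in
/-- A palindrome with leading digit and middle digit `1` which is not squarefree has a square
divisor in one of the ranges under control. -/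
lemma card_le_of_forall_not_squarefree {b k e₀ : ℕ} (hb : 2 ≤ b) (hk : 1 ≤ k)
    (h : ∀ a ∈ Finset.Ico (b ^ (k - 1)) (2 * b ^ (k - 1)), ¬ Squarefree (mirror b k (a * b + 1))) :
    b ^ (k - 1) ≤
      ∑ d ∈ (Finset.range (b ^ e₀)).filter fun d => Odd d ∧ 3 ≤ d ∧ d.Coprime b,
        ((Finset.Ico (b ^ (k - 1)) (2 * b ^ (k - 1))).filter
          fun a => d ^ 2 ∣ mirror b k (a * b + 1)).card +
      ∑ e ∈ Finset.Ico e₀ (k + 1),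
        ((Finset.Ico (b ^ k) (b ^ (k + 1))).filter fun a => HasSquareDivisor b k e a).card := by
  set F := Finset.Ico (b ^ (k - 1)) (2 * b ^ (k - 1)) with hF
  set S := (Finset.range (b ^ e₀)).filter fun d => Odd d ∧ 3 ≤ d ∧ d.Coprime b with hS
  have hFcard : F.card = b ^ (k - 1) := by rw [hF, Nat.card_Ico, two_mul, Nat.add_sub_cancel]
  have hb0 : 0 < b := by omega
  have hsub : F ⊆ (S.biUnion fun d => F.filter fun a => d ^ 2 ∣ mirror b k (a * b + 1)) ∪
      ((Finset.Ico e₀ (k + 1)).biUnion fun e =>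
        F.filter fun a => HasSquareDivisor b k e (a * b + 1)) := by
    intro a ha
    have hns := h a ha
    have ha2 := Finset.mem_Ico.1 ha
    obtain ⟨hodd, hmod, hge, hlt⟩ := odd_mirror hb hk ha2.1 ha2.2
    have hn0 : mirror b k (a * b + 1) ≠ 0 := hodd.pos.ne'
    rw [Squarefree] at hns
    push Not at hns
    obtain ⟨d, hd, hd1⟩ := hns
    rw [Nat.isUnit_iff] at hd1
    have hdn : d ∣ mirror b k (a * b + 1) := (Dvd.intro _ rfl).trans hd
    have hdodd : Odd d := hodd.of_dvd_nat hdn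
    have hd3 : 3 ≤ d := by
      rcases hdodd with ⟨c, rfl⟩
      omega
    have hcop : d.Coprime b := by
      have : (mirror b k (a * b + 1)).Coprime b := by
        rw [Nat.coprime_iff_gcd_eq_one, hmod.gcd_eq, Nat.gcd_one_left]
      exact this.coprime_dvd_left hdn
    rw [← sq] at hd
    rw [Finset.mem_union, Finset.mem_biUnion, Finset.mem_biUnion]
    rcases lt_or_ge d (b ^ e₀) with hsmall | hbig
    · left
      refine ⟨d, ?_, Finset.mem_filter.2 ⟨ha, hd⟩⟩
      simp only [hS, Finset.mem_filter, Finset.mem_range]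
      exact ⟨hsmall, hdodd, hd3, hcop⟩
    · right
      have h1 : b ^ Nat.log b d ≤ d := Nat.pow_log_le_self b (by omega)
      have h2 : d < b ^ (Nat.log b d + 1) := Nat.lt_pow_succ_log_self (by omega) d
      refine ⟨Nat.log b d, Finset.mem_Ico.2 ⟨?_, ?_⟩,
        Finset.mem_filter.2 ⟨ha, d, h1, h2, hcop, hd⟩⟩
      · exact Nat.le_log_of_pow_le (by omega) hbig
      · have h3 : b ^ (2 * Nat.log b d) < b ^ (2 * k + 1) :=
          calc b ^ (2 * Nat.log b d) = (b ^ Nat.log b d) ^ 2 := by rw [← pow_mul, mul_comm]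
            _ ≤ d ^ 2 := Nat.pow_le_pow_left h1 2
            _ ≤ _ := Nat.le_of_dvd (Nat.pos_of_ne_zero hn0) hd
            _ < _ := mirror_lt hb0 _ _ hlt
        have := (Nat.pow_lt_pow_iff_right (by omega)).1 h3
        omega
  rw [← hFcard]
  refine (Finset.card_le_card hsub).trans ((Finset.card_union_le _ _).trans ?_)
  refine add_le_add Finset.card_biUnion_le
    (Finset.card_biUnion_le.trans (Finset.sum_le_sum fun e _ => ?_))
  refine Finset.card_le_card_of_injOn (fun a => a * b + 1) ?_ ?_
  · intro a ha
    simp only [Finset.coe_filter, Set.mem_ofPred_eq] at ha ⊢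
    have ha2 := Finset.mem_Ico.1 ha.1
    obtain ⟨-, -, hge, hlt⟩ := odd_mirror hb hk ha2.1 ha2.2
    exact ⟨Finset.mem_Ico.2 ⟨hge, hlt⟩, ha.2⟩
  · intro a _ a' _ haa
    exact Nat.eq_of_mul_eq_mul_right hb0 (Nat.add_right_cancel haa)

lemma mul_succ_le_two_pow {C j : ℕ} (hj : 4 * C ≤ j) : C * (j + 1) ≤ 2 ^ j := by
  have h1 : j / 2 < 2 ^ (j / 2) := Nat.lt_two_pow_self
  have h2 : 2 * C ≤ j / 2 := by omega
  calc C * (j + 1) ≤ C * (2 * (j / 2 + 1)) := Nat.mul_le_mul_left _ (by omega)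
    _ = 2 * C * (j / 2 + 1) := by ring
    _ ≤ 2 ^ (j / 2) * 2 ^ (j / 2) := Nat.mul_le_mul (by omega) h1
    _ = 2 ^ (j / 2 + j / 2) := by rw [pow_add]
    _ ≤ 2 ^ j := Nat.pow_le_pow_right (by norm_num) (by omega)

open Classical in
lemma exists_sum_card_hasSquareDivisor_le {b : ℕ} (hb : 2 ≤ b) :
    ∃ e₀ K, ∀ k, K ≤ k → 1 ≤ k →
      ((∑ e ∈ Finset.Ico e₀ (k + 1), ((Finset.Ico (b ^ k) (b ^ (k + 1))).filter
        fun a => HasSquareDivisor b k e a).card : ℕ) : ℝ) ≤ 1 / 4 * (b : ℝ) ^ (k - 1) := by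
  have hb' : (2 : ℝ) ≤ b := by exact_mod_cast hb
  have hbpos : (0 : ℝ) < b := by linarith
  obtain ⟨e₁, he₁⟩ := exists_pow_lt_of_lt_one (y := (97 / 100 : ℝ))
    (show (0 : ℝ) < 1 / (1600 * (b : ℝ) ^ 4) by positivity) (by norm_num)
  set C := 88 * ((b ^ 2 + 1) * b ^ 2) with hC
  refine ⟨e₁ + 8, 11 * (4 * C), fun k hk hk1 => ?_⟩
  obtain ⟨r, rfl⟩ : ∃ r, k = r + 1 := ⟨k - 1, by omega⟩
  rw [Nat.add_sub_cancel]
  have hterm : ∀ e ∈ Finset.Ico (e₁ + 8) (r + 1 + 1),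
      (((Finset.Ico (b ^ (r + 1)) (b ^ (r + 1 + 1))).filter
        fun a => HasSquareDivisor b (r + 1) e a).card : ℝ) ≤
      6 * (b : ℝ) ^ 3 * (b : ℝ) ^ (r + 1) * (97 / 100) ^ e +
        ((b : ℝ) ^ 2 + 1) * (b : ℝ) ^ (r + 1 + 1) / (b : ℝ) ^ ((r + 1) / 11) := by
    intro e he
    rw [Finset.mem_Ico] at he
    rcases le_or_gt (11 * e) (8 * (r + 1 + 1)) with hle | hgt
    · have h1 := card_hasSquareDivisor_le_of_le hb (k := r + 1) (e := e) (by omega) hle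
      have h2 : ((Finset.Ico (b ^ (r + 1)) (b ^ (r + 1 + 1))).filter
          fun a => HasSquareDivisor b (r + 1) e a).card ≤
          ((Finset.range (b ^ (r + 1 + 1))).filter
            fun a => HasSquareDivisor b (r + 1) e a).card := by
        refine Finset.card_le_card (Finset.filter_subset_filter _ fun x hx => ?_)
        exact Finset.mem_range.2 (Finset.mem_Ico.1 hx).2
      have h3 : (0 : ℝ) ≤ ((b : ℝ) ^ 2 + 1) * (b : ℝ) ^ (r + 1 + 1) / (b : ℝ) ^ ((r + 1) / 11) := by
        positivity
      have h4 := (Nat.cast_le (α := ℝ)).2 h2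
      linarith
    · have h1 := card_hasSquareDivisor_mul_le hb (k := r + 1) (e := e) (by omega) hgt
      have h2 := (Nat.cast_le (α := ℝ)).2 h1
      push_cast at h2
      rw [← le_div_iff₀ (by positivity)] at h2
      have h3 : (0 : ℝ) ≤ 6 * (b : ℝ) ^ 3 * (b : ℝ) ^ (r + 1) * (97 / 100) ^ e := by positivity
      linarith
  rw [Nat.cast_sum]
  refine (Finset.sum_le_sum hterm).trans ?_
  rw [Finset.sum_add_distrib, ← Finset.mul_sum, Finset.sum_const, nsmul_eq_mul]
  have hgeom : ∑ e ∈ Finset.Ico (e₁ + 8) (r + 1 + 1), (97 / 100 : ℝ) ^ e ≤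
      (97 / 100) ^ (e₁ + 8) / (1 - 97 / 100) :=
    geom_sum_Ico_le_of_lt_one (by norm_num) (by norm_num)
  have hgeom2 : ∑ e ∈ Finset.Ico (e₁ + 8) (r + 1 + 1), (97 / 100 : ℝ) ^ e ≤
      1 / (48 * (b : ℝ) ^ 4) := by
    have h1 : (97 / 100 : ℝ) ^ (e₁ + 8) ≤ (97 / 100) ^ e₁ :=
      pow_le_pow_of_le_one (by norm_num) (by norm_num) (by omega)
    refine hgeom.trans ?_
    rw [div_le_iff₀ (by norm_num)]
    have : 1 / (48 * (b : ℝ) ^ 4) * (1 - 97 / 100) = 1 / (1600 * (b : ℝ) ^ 4) := by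
      field_simp
      norm_num
    rw [this]
    linarith
  have hA : 6 * (b : ℝ) ^ 3 * (b : ℝ) ^ (r + 1) *
      ∑ e ∈ Finset.Ico (e₁ + 8) (r + 1 + 1), (97 / 100 : ℝ) ^ e ≤ 1 / 8 * (b : ℝ) ^ r := by
    refine (mul_le_mul_of_nonneg_left hgeom2 (by positivity)).trans_eq ?_
    field_simp
    ring
  have hB : ((Finset.Ico (e₁ + 8) (r + 1 + 1)).card : ℝ) *
      (((b : ℝ) ^ 2 + 1) * (b : ℝ) ^ (r + 1 + 1) / (b : ℝ) ^ ((r + 1) / 11)) ≤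
      1 / 8 * (b : ℝ) ^ r := by
    have h1 : C * ((r + 1) / 11 + 1) ≤ b ^ ((r + 1) / 11) :=
      (mul_succ_le_two_pow (by omega)).trans (Nat.pow_le_pow_left hb _)
    have h2 : 8 * ((Finset.Ico (e₁ + 8) (r + 1 + 1)).card * ((b ^ 2 + 1) * b ^ 2)) ≤
        b ^ ((r + 1) / 11) := by
      refine le_trans ?_ h1
      rw [Nat.card_Ico, hC]
      calc _ ≤ 8 * (11 * ((r + 1) / 11 + 1) * ((b ^ 2 + 1) * b ^ 2)) :=
            Nat.mul_le_mul_left _ (Nat.mul_le_mul_right _ (by omega))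
        _ = _ := by ring
    have h3 := (Nat.cast_le (α := ℝ)).2 h2
    push_cast at h3
    rw [← mul_div_assoc, div_le_iff₀ (by positivity)]
    have h4 : (0 : ℝ) ≤ (b : ℝ) ^ r := by positivity
    calc _ = 1 / 8 * (b : ℝ) ^ r * (8 * (((Finset.Ico (e₁ + 8) (r + 1 + 1)).card : ℝ) *
          (((b : ℝ) ^ 2 + 1) * (b : ℝ) ^ 2))) := by ring
      _ ≤ _ := mul_le_mul_of_nonneg_left h3 (by positivity)
  linarith

/-- For every fixed base `b ≥ 2`, there exist infinitely many positive integers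
that are square-free and are palindromes in base `b`. -/
theorem infinitely_many_squarefree_palindromes (b : ℕ) (hb : 2 ≤ b) :
    {n : ℕ | 0 < n ∧ Squarefree n ∧ IsBPalindrome b n}.Infinite := by
  classical
  have hb' : (2 : ℝ) ≤ b := by exact_mod_cast hb
  obtain ⟨e₀, K, hK⟩ := exists_sum_card_hasSquareDivisor_le hb
  obtain ⟨g, hg, hev⟩ := exists_eventually_sum_card_dvd_mirror_le hb (b ^ e₀)
  refine Set.infinite_of_forall_exists_gt fun N => ?_
  obtain ⟨m, hm, hmK⟩ := (hev.and (Filter.eventually_ge_atTop (K + N))).exists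
  set k := g * (m + 1) with hk
  have hkm : m + 1 ≤ k := Nat.le_mul_of_pos_left _ hg
  have hlarge := hK k (by omega) (by omega)
  obtain ⟨a, ha, hsq⟩ : ∃ a ∈ Finset.Ico (b ^ (k - 1)) (2 * b ^ (k - 1)),
      Squarefree (mirror b k (a * b + 1)) := by
    by_contra! hcon
    have h := (Nat.cast_le (α := ℝ)).2
      (card_le_of_forall_not_squarefree (e₀ := e₀) hb (by omega) hcon)
    rw [Nat.cast_add, Nat.cast_pow] at h
    have : (0 : ℝ) < (b : ℝ) ^ (k - 1) := by positivity
    linarith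
  have ha2 := Finset.mem_Ico.1 ha
  obtain ⟨hodd, hmod, hge, hlt⟩ := odd_mirror hb (by omega) ha2.1 ha2.2
  refine ⟨mirror b k (a * b + 1), ⟨hodd.pos, hsq, isBPalindrome_mirror hb k _ hge hlt ?_⟩, ?_⟩
  · intro hdvd
    have := Nat.le_of_dvd one_pos ((hmod.dvd_iff dvd_rfl).1 hdvd)
    omega
  · calc N < 2 ^ N := Nat.lt_two_pow_self
      _ ≤ b ^ k := (Nat.pow_le_pow_left hb N).trans (Nat.pow_le_pow_right (by omega) (by omega))
      _ ≤ a * b + 1 := hge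
      _ ≤ (a * b + 1) * b ^ k := Nat.le_mul_of_pos_right _ (by positivity)
      _ ≤ _ := Nat.le_add_right _ _
end

section
/- Fix b ≥ 2. There is a constant C depending only on b such that for all integers a and m with gcd(a, b) = 1, every N ≥ 1, every positive divisor c of b^N, and every real Q ≥ 1: Σ_{q ∈ ℤ, |q| ≤ Q} |K₂(m, a, −a, q, c)| ≤ C (Q + b^{N/2}). -/
/-- The additive character `e(z/c)` for `z ∈ ℤ/cℤ`. -/
noncomputable def eMod (c : ℕ) (z : ZMod c) : ℂ :=
  Complex.exp (2 * Real.pi * Complex.I * ((z.val : ℂ) / (c : ℂ)))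

/-- The quadratic Kloosterman sum
`K₂(a₁,a₂,a₃,q,c) = c^{-1/2} Σ_{1 ≤ x ≤ c, (x(x+q),c)=1} e((a₁x + a₂x̄² + a₃(x+q)̄²)/c)`. -/
noncomputable def K2 (a₁ a₂ a₃ q : ℤ) (c : ℕ) : ℂ :=
  ((Real.sqrt c)⁻¹ : ℝ) * ∑ x ∈ Finset.Icc 1 c,
    if Int.gcd ((x : ℤ) * ((x : ℤ) + q)) (c : ℤ) = 1 then
      eMod c ((a₁ : ZMod c) * (x : ZMod c) + (a₂ : ZMod c) * ((x : ZMod c)⁻¹) ^ 2 +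
        (a₃ : ZMod c) * ((((x : ℤ) + q : ℤ) : ZMod c)⁻¹) ^ 2)
    else 0

open Finset

theorem sum_range_mul_eq_sum_sum {M : Type*} [AddCommMonoid M] (f : ℕ → M) (d r : ℕ) :
    ∑ x ∈ range (d * r), f x = ∑ u ∈ range d, ∑ t ∈ range r, f (u + d * t) := by
  rw [sum_comm]
  induction r with
  | zero => simp
  | succ r ih =>
    rw [Nat.mul_succ, sum_range_add, ih, sum_range_succ]
    simp only [add_comm]

theorem exists_mul_mul_sq_of_dvd_pow {b N c : ℕ} (hN : N ≠ 0) (hc : c ∣ b ^ N) :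
    ∃ s r : ℕ, c = s * r ^ 2 ∧ s ∣ b := by
  obtain ⟨s, r, h, hs⟩ := Nat.sq_mul_squarefree c
  refine ⟨s, r, by rw [← h, mul_comm], ?_⟩
  exact (hs.dvd_pow_iff_dvd hN).1 ((Dvd.intro_left _ h).trans hc)

theorem eMod_eq_stdAddChar {c : ℕ} [NeZero c] (z : ZMod c) : eMod c z = ZMod.stdAddChar z := by
  rw [ZMod.stdAddChar_apply, ZMod.toCircle_apply, eMod, mul_div_assoc]

theorem norm_eMod {c : ℕ} (z : ZMod c) : ‖eMod c z‖ = 1 := by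
  rw [eMod, show (2 * Real.pi * Complex.I * ((z.val : ℂ) / (c : ℂ)) : ℂ) =
    ((2 * Real.pi * (z.val / c) : ℝ) : ℂ) * Complex.I by push_cast; ring,
    Complex.norm_exp_ofReal_mul_I]

theorem eMod_add {c : ℕ} [NeZero c] (y z : ZMod c) : eMod c (y + z) = eMod c y * eMod c z := by
  simp only [eMod_eq_stdAddChar, AddChar.map_add_eq_mul]

theorem sum_eMod_natCast_mul_eq_zero {c : ℕ} [NeZero c] {g : ZMod c} (hg : g ≠ 0) {r : ℕ}
    (hr : (r : ZMod c) * g = 0) : ∑ t ∈ range r, eMod c (t * g) = 0 := by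
  have h : ∀ t : ℕ, eMod c (t * g) = ZMod.stdAddChar g ^ t := fun t => by
    rw [eMod_eq_stdAddChar, ← nsmul_eq_mul, AddChar.map_nsmul_eq_pow]
  have h1 : ZMod.stdAddChar g ≠ (1 : ℂ) := fun H =>
    hg (ZMod.injective_stdAddChar (by rw [H, AddChar.map_zero_eq_one]))
  simp only [h]
  rw [geom_sum_eq h1, ← h, hr, eMod_eq_stdAddChar, AddChar.map_zero_eq_one, sub_self, zero_div]

theorem ZMod.add_mul_sub_of_sq_eq_zero {c : ℕ} {u D : ZMod c} (hu : IsUnit u) (hD : D ^ 2 = 0) :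
    (u + D) * (u⁻¹ - D * u⁻¹ ^ 2) = 1 := by
  have h := ZMod.mul_inv_of_unit u hu
  linear_combination (1 - D * u⁻¹) * h - u⁻¹ ^ 2 * hD

theorem ZMod.isUnit_add_iff_of_sq_eq_zero {c : ℕ} {u D : ZMod c} (hD : D ^ 2 = 0) :
    IsUnit (u + D) ↔ IsUnit u := by
  refine ⟨fun h => ?_, fun h => IsUnit.of_mul_eq_one _ (ZMod.add_mul_sub_of_sq_eq_zero h hD)⟩
  have := IsUnit.of_mul_eq_one _ (ZMod.add_mul_sub_of_sq_eq_zero (D := -D) h (by simpa using hD))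
  simpa using this

theorem ZMod.inv_add_sq_of_sq_eq_zero {c : ℕ} {u D : ZMod c} (hu : IsUnit u) (hD : D ^ 2 = 0) :
    (u + D)⁻¹ ^ 2 = u⁻¹ ^ 2 - 2 * D * u⁻¹ ^ 3 := by
  rw [ZMod.inv_eq_of_mul_eq_one _ _ _ (ZMod.add_mul_sub_of_sq_eq_zero hu hD)]
  linear_combination u⁻¹ ^ 4 * hD

/-- The derivative of the phase of `K2 m a (-a) q c` at `u`, where `y = u + q`. -/
def phaseDeriv {c : ℕ} (m a u y : ZMod c) : ZMod c :=
  m - 2 * a * u⁻¹ ^ 3 + 2 * a * y⁻¹ ^ 3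

open Classical in
/-- The points `u` modulo `d` where the phase of `K2 m a (-a) q c` is stationary. -/
noncomputable def stationaryPoints (m a q : ℤ) (c d : ℕ) : Finset ℕ :=
  (range d).filter fun u : ℕ => IsUnit (u : ZMod c) ∧
    IsUnit (((u + q : ℤ)) : ZMod c) ∧
    (d : ZMod c) * phaseDeriv (m : ZMod c) a u ((u + q : ℤ) : ZMod c) = 0

open Classical in
/-- The summand of `K2 m a (-a) q c`, as a function on `ZMod c`. -/
noncomputable def kloostermanTerm {c : ℕ} (m a q x : ZMod c) : ℂ :=
  if IsUnit x ∧ IsUnit (x + q) then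
    eMod c (m * x + a * x⁻¹ ^ 2 + -a * (x + q)⁻¹ ^ 2) else 0

theorem K2_eq_sum_range (m a q : ℤ) (c : ℕ) :
    K2 m a (-a) q c =
      ((Real.sqrt c)⁻¹ : ℝ) * ∑ x ∈ range c, kloostermanTerm (c := c) m a q (x : ZMod c) := by
  classical
  rw [K2]
  congr 1
  have h1 : ∑ x ∈ range c, kloostermanTerm (c := c) m a q (x : ZMod c) =
      ∑ x ∈ Icc 1 c, kloostermanTerm (c := c) m a q (x : ZMod c) := by
    have h := sum_range_succ (fun x : ℕ => kloostermanTerm (c := c) m a q (x : ZMod c)) c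
    rw [range_eq_Ico, sum_eq_sum_Ico_succ_bot c.succ_pos] at h
    rw [ZMod.natCast_self, Nat.cast_zero, add_comm] at h
    exact (add_right_cancel h).symm
  rw [h1]
  refine sum_congr rfl fun x _ => ?_
  have h2 : Int.gcd ((x : ℤ) * ((x : ℤ) + q)) (c : ℤ) = 1 ↔
      IsUnit (x : ZMod c) ∧ IsUnit ((x : ZMod c) + q) := by
    rw [← Int.isCoprime_iff_gcd_eq_one, ← IsUnit.mul_iff]
    have := ZMod.coe_int_isUnit_iff_isCoprime ((x : ℤ) * (x + q)) c
    push_cast at this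
    rw [this, isCoprime_comm]
  rw [kloostermanTerm]
  refine if_congr h2 ?_ rfl
  push_cast
  rfl

open Classical in
theorem norm_sum_kloostermanTerm_le {c d r : ℕ} [NeZero c] (hc : c = d * r) (hd : c ∣ d ^ 2)
    (m a q : ZMod c) (u : ℕ) :
    ‖∑ t ∈ range r, kloostermanTerm m a q ((u + d * t : ℕ) : ZMod c)‖ ≤
      if IsUnit (u : ZMod c) ∧ IsUnit (u + q) ∧
        (d : ZMod c) * phaseDeriv m a u (u + q) = 0 then (r : ℝ) else 0 := by
  have hD : ∀ t : ℕ, ((d : ZMod c) * t) ^ 2 = 0 := fun t => by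
    rw [mul_pow, ← Nat.cast_pow, (ZMod.natCast_eq_zero_iff _ _).2 hd, zero_mul]
  have hunit : ∀ t : ℕ,
      IsUnit ((u + d * t : ℕ) : ZMod c) ∧ IsUnit (((u + d * t : ℕ) : ZMod c) + q) ↔
        IsUnit (u : ZMod c) ∧ IsUnit (u + q) := fun t => by
    push_cast
    rw [add_right_comm, ZMod.isUnit_add_iff_of_sq_eq_zero (hD t),
      ZMod.isUnit_add_iff_of_sq_eq_zero (hD t)]
  by_cases hu : IsUnit (u : ZMod c) ∧ IsUnit (u + q)
  · have hterm : ∀ t : ℕ, kloostermanTerm m a q ((u + d * t : ℕ) : ZMod c) =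
        kloostermanTerm m a q (u : ZMod c) *
          eMod c (t * ((d : ZMod c) * phaseDeriv m a u (u + q))) := fun t => by
      have h3 : (u : ZMod c) + d * t + q = u + q + d * t := by ring
      rw [kloostermanTerm, kloostermanTerm, if_pos ((hunit t).2 hu)]
      push_cast
      rw [h3, if_pos hu, ← eMod_add, ZMod.inv_add_sq_of_sq_eq_zero hu.1 (hD t),
        ZMod.inv_add_sq_of_sq_eq_zero hu.2 (hD t), phaseDeriv]
      congr 1
      ring
    simp only [hterm]
    rw [← mul_sum]
    have hle : ‖kloostermanTerm m a q (u : ZMod c)‖ ≤ 1 := by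
      rw [kloostermanTerm, if_pos hu, norm_eMod]
    split_ifs with h
    · rw [h.2.2]
      refine (norm_mul_le _ _).trans ?_
      refine (mul_le_of_le_one_left (norm_nonneg _) hle).trans ?_
      refine (norm_sum_le _ _).trans ?_
      simp [norm_eMod]
    · rw [sum_eMod_natCast_mul_eq_zero (fun H => h ⟨hu.1, hu.2, H⟩), mul_zero, norm_zero]
      rw [← mul_assoc, ← Nat.cast_mul, mul_comm r d, ← hc, ZMod.natCast_self, zero_mul]
  · have hterm : ∀ t : ℕ, kloostermanTerm m a q ((u + d * t : ℕ) : ZMod c) = 0 := fun t => by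
      rw [kloostermanTerm, if_neg (mt (hunit t).1 hu)]
    simp only [hterm, sum_const_zero, norm_zero]
    split_ifs <;> positivity

theorem norm_K2_le_card_stationaryPoints {c d r : ℕ} [NeZero c] (hc : c = d * r) (hr : r ∣ d)
    (m a q : ℤ) : ‖K2 m a (-a) q c‖ ≤ #(stationaryPoints m a q c d) := by
  classical
  have hd : c ∣ d ^ 2 := by rw [hc, sq]; exact mul_dvd_mul_left d hr
  have hc0 : 0 < c := Nat.pos_of_ne_zero (NeZero.ne c)
  have hd0 : 0 < d := Nat.pos_of_ne_zero fun h => by simp [h] at hc; omega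
  have hsum : ‖∑ x ∈ range c, kloostermanTerm (c := c) m a q (x : ZMod c)‖ ≤
      r * #(stationaryPoints m a q c d) := by
    conv_lhs => rw [show range c = range (d * r) by rw [← hc]]
    rw [sum_range_mul_eq_sum_sum (fun x : ℕ => kloostermanTerm (c := c) m a q (x : ZMod c))]
    refine (norm_sum_le _ _).trans
      ((sum_le_sum fun u _ => norm_sum_kloostermanTerm_le hc hd _ _ _ u).trans ?_)
    rw [← sum_filter, sum_const, nsmul_eq_mul, mul_comm]
    simp [stationaryPoints]
  have hrs : (r : ℝ) ≤ Real.sqrt c := by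
    refine Real.le_sqrt_of_sq_le ?_
    rw [hc]
    have h : r ^ 2 ≤ d * r := by
      rw [sq]
      exact Nat.mul_le_mul_right r (Nat.le_of_dvd hd0 hr)
    exact_mod_cast h
  have hs : 0 < Real.sqrt c := Real.sqrt_pos.2 (by exact_mod_cast hc0)
  rw [K2_eq_sum_range, norm_mul, Complex.norm_real, norm_inv, Real.norm_of_nonneg hs.le,
    inv_mul_le_iff₀ hs]
  exact hsum.trans (by gcongr)

/-- Cubing is injective up to a factor `6` on each residue class modulo `3 * b`. -/
theorem dvd_six_mul_sub_of_dvd_two_mul_cube_sub {b y z r : ℤ} {N : ℕ} (hr0 : r ≠ 0) (hr : r ∣ b ^ N)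
    (hy : IsCoprime y r) (hmod : 3 * b ∣ z - y) (h : r ∣ 2 * (z ^ 3 - y ^ 3)) :
    r ∣ 6 * (z - y) := by
  obtain ⟨k, hk⟩ := hmod
  have hz : z = y + 3 * b * k := by linarith
  have hcop : IsCoprime r (y ^ 2 + b * (3 * k * y + 3 * b * k ^ 2)) := by
    refine isCoprime_of_prime_dvd (fun H => hr0 H.1) fun p hp hpr hpy => hp.not_isUnit ?_
    have hpb : p ∣ b := hp.dvd_of_dvd_pow (hpr.trans hr)
    have hpy' : p ∣ y := hp.dvd_of_dvd_pow ((dvd_add_left (hpb.mul_right _)).1 hpy)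
    exact hy.isUnit_of_dvd' hpy' hpr
  refine hcop.dvd_of_dvd_mul_left ?_
  have h2 : (y ^ 2 + b * (3 * k * y + 3 * b * k ^ 2)) * (6 * (z - y)) =
      2 * (z ^ 3 - y ^ 3) := by
    rw [hz]
    ring
  rwa [h2]

theorem card_le_of_cube_congr {b s r : ℕ} {N : ℕ} (hb : 0 < b) (hs : 0 < s) (hr0 : 0 < r)
    (hr : r ∣ b ^ N) {L : ℤ} {B : ℕ} (S : Finset ℤ)
    (hS : ∀ y ∈ S, L ≤ y ∧ y ≤ L + B ∧ IsCoprime y (r : ℤ))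
    (hS' : ∀ y ∈ S, ∀ z ∈ S, (r : ℤ) ∣ 2 * (z ^ 3 - y ^ 3)) :
    #S ≤ 3 * b * (6 * s * B / (s * r) + 1) := by
  have hsr : (0 : ℤ) < s * r := by positivity
  have hb' : (0 : ℤ) < 3 * b := by positivity
  let φ : ℤ → ℤ × ℤ := fun y => (y % (3 * b), 6 * s * (y - L) / (s * r))
  have hφ : Set.InjOn φ S := by
    intro y hy z hz hyz
    obtain ⟨h1, h2⟩ := Prod.mk.inj hyz
    have h3 := dvd_six_mul_sub_of_dvd_two_mul_cube_sub (b := b) (N := N)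
      (by positivity) (by exact_mod_cast hr)
      (hS y hy).2.2 (Int.ModEq.dvd h1) (hS' y hy z hz)
    have h4 : (s * r : ℤ) ∣ 6 * s * (z - L) - 6 * s * (y - L) := by
      rw [show (6 * s * (z - L) - 6 * s * (y - L) : ℤ) = s * (6 * (z - y)) by ring]
      exact mul_dvd_mul_left (s : ℤ) h3
    have h5 : 6 * s * (y - L) % (s * r : ℤ) = 6 * s * (z - L) % (s * r) :=
      Int.modEq_iff_dvd.2 h4
    have h6 : 6 * s * (y - L) = 6 * s * (z - L) := by
      rw [← Int.mul_ediv_add_emod (6 * s * (y - L)) (s * r), h2, h5, Int.mul_ediv_add_emod]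
    have h7 : (6 * s : ℤ) ≠ 0 := by positivity
    have := mul_left_cancel₀ h7 h6
    linarith
  have hmaps : ∀ y ∈ S, φ y ∈ Ico (0 : ℤ) (3 * b : ℕ) ×ˢ
      Ico (0 : ℤ) ((6 * s * B / (s * r) + 1 : ℕ) : ℤ) := by
    intro y hy
    obtain ⟨h1, h2, -⟩ := hS y hy
    simp only [φ, mem_product, mem_Ico]
    refine ⟨⟨Int.emod_nonneg _ hb'.ne', by push_cast; exact Int.emod_lt_of_pos _ hb'⟩,
      Int.ediv_nonneg (mul_nonneg (by positivity) (by linarith)) hsr.le, ?_⟩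
    push_cast
    refine Int.lt_add_one_of_le (Int.ediv_le_ediv hsr ?_)
    gcongr
    linarith
  have := card_le_card_of_injOn φ hmaps hφ
  rwa [card_product, Int.card_Ico, Int.card_Ico, sub_zero, sub_zero, Int.toNat_natCast,
    Int.toNat_natCast] at this

theorem dvd_two_mul_cube_sub_of_phaseDeriv {c d r : ℕ} (hd : 0 < d) (hc : c = d * r)
    {a m : ℤ} (ha : IsCoprime a (c : ℤ)) (u : ZMod c) {y z : ℤ}
    (hy : IsUnit (y : ZMod c)) (hz : IsUnit (z : ZMod c))
    (hfy : (d : ZMod c) * phaseDeriv (m : ZMod c) a u y = 0)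
    (hfz : (d : ZMod c) * phaseDeriv (m : ZMod c) a u z = 0) :
    (r : ℤ) ∣ 2 * (z ^ 3 - y ^ 3) := by
  have hau : IsUnit (a : ZMod c) := (ZMod.coe_int_isUnit_iff_isCoprime a c).2 ha.symm
  have h1 : ((d * (2 * (z ^ 3 - y ^ 3)) : ℤ) : ZMod c) = 0 := by
    rw [← hau.mul_right_eq_zero]
    push_cast
    have e1 := ZMod.mul_inv_of_unit _ hy
    have e2 := ZMod.mul_inv_of_unit _ hz
    have e3 : (y : ZMod c) ^ 3 * (y : ZMod c)⁻¹ ^ 3 = 1 := by rw [← mul_pow, e1, one_pow]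
    have e4 : (z : ZMod c) ^ 3 * (z : ZMod c)⁻¹ ^ 3 = 1 := by rw [← mul_pow, e2, one_pow]
    simp only [phaseDeriv] at hfy hfz
    linear_combination (y : ZMod c) ^ 3 * (z : ZMod c) ^ 3 * (hfy - hfz) -
      2 * a * d * (z : ZMod c) ^ 3 * e3 + 2 * a * d * (y : ZMod c) ^ 3 * e4
  rw [ZMod.intCast_zmod_eq_zero_iff_dvd, hc] at h1
  push_cast at h1
  exact Int.dvd_of_mul_dvd_mul_left (by positivity) h1

theorem sum_card_stationaryPoints_le {b s r N c : ℕ} (hb : 0 < b) (hc0 : 0 < c)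
    (hc : c = s * r * r) (hcb : c ∣ b ^ N) {a m : ℤ} (ha : IsCoprime a (c : ℤ)) (n : ℕ) :
    ∑ q ∈ Icc (-n : ℤ) n, #(stationaryPoints m a q c (s * r)) ≤
      36 * b * s * n + 3 * b * (s * r) := by
  classical
  have hs : 0 < s := Nat.pos_of_ne_zero fun h => by simp [h] at hc; omega
  have hr : 0 < r := Nat.pos_of_ne_zero fun h => by simp [h] at hc; omega
  have hrc : r ∣ c := Dvd.intro_left _ hc.symm
  refine (sum_card_bipartiteAbove_eq_sum_card_bipartiteBelow (s := Icc (-n : ℤ) n)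
    (t := range (s * r))
    (fun (q : ℤ) (u : ℕ) => IsUnit (u : ZMod c) ∧ IsUnit (((u + q : ℤ)) : ZMod c) ∧
      ((s * r : ℕ) : ZMod c) * phaseDeriv (m : ZMod c) a u ((u + q : ℤ) : ZMod c) = 0)).trans_le ?_
  have key : ∀ u ∈ range (s * r), #((Icc (-n : ℤ) n).filter fun q : ℤ =>
      IsUnit (u : ZMod c) ∧ IsUnit (((u + q : ℤ)) : ZMod c) ∧
      ((s * r : ℕ) : ZMod c) * phaseDeriv (m : ZMod c) a u ((u + q : ℤ) : ZMod c) = 0) ≤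
      3 * b * (6 * s * (2 * n) / (s * r) + 1) := by
    intro u _
    rw [← card_image_of_injective _ (add_right_injective (u : ℤ))]
    have hmem : ∀ y, y ∈ image (fun q : ℤ => u + q) ((Icc (-n : ℤ) n).filter fun q : ℤ =>
      IsUnit (u : ZMod c) ∧ IsUnit (((u + q : ℤ)) : ZMod c) ∧
      ((s * r : ℕ) : ZMod c) * phaseDeriv (m : ZMod c) a u ((u + q : ℤ) : ZMod c) = 0) →
      (u - n ≤ y ∧ y ≤ u - n + (2 * n : ℕ)) ∧ IsUnit ((y : ℤ) : ZMod c) ∧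
      ((s * r : ℕ) : ZMod c) * phaseDeriv (m : ZMod c) a u (y : ZMod c) = 0 := by
      intro y hy
      simp only [mem_image, mem_filter, mem_Icc] at hy
      obtain ⟨q, ⟨⟨h1, h2⟩, -, h4, h5⟩, rfl⟩ := hy
      exact ⟨⟨by linarith, by push_cast; linarith⟩, h4, h5⟩
    refine card_le_of_cube_congr hb hs hr (hrc.trans hcb) (L := u - n) _ (fun y hy => ?_)
      fun y hy z hz => ?_
    · obtain ⟨⟨h1, h2⟩, h3, -⟩ := hmem y hy
      refine ⟨h1, h2, ?_⟩
      exact ((ZMod.coe_int_isUnit_iff_isCoprime y c).1 h3).symm.of_isCoprime_of_dvd_right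
        (Int.natCast_dvd_natCast.2 hrc)
    · obtain ⟨-, h3, h4⟩ := hmem y hy
      obtain ⟨-, h5, h6⟩ := hmem z hz
      exact dvd_two_mul_cube_sub_of_phaseDeriv (by positivity) hc ha _ h3 h5 h4 h6
  refine (sum_le_sum key).trans ?_
  rw [sum_const, card_range, smul_eq_mul]
  calc s * r * (3 * b * (6 * s * (2 * n) / (s * r) + 1))
      = 3 * b * (6 * s * (2 * n) / (s * r) * (s * r)) + 3 * b * (s * r) := by ring
    _ ≤ 3 * b * (6 * s * (2 * n)) + 3 * b * (s * r) := by
        have := Nat.div_mul_le_self (6 * s * (2 * n)) (s * r)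
        exact Nat.add_le_add_right (Nat.mul_le_mul_left _ this) _
    _ = _ := by ring

/-- For fixed `b ≥ 2` there is a constant `C = C(b)` such that for all integers
`a, m` with `gcd(a,b) = 1`, all `N ≥ 1`, every divisor `c` of `b^N` and every
real `Q ≥ 1`, `Σ_{|q| ≤ Q} |K₂(m, a, -a, q, c)| ≤ C (Q + b^{N/2})`. -/
theorem K2_average_bound (b : ℕ) (hb : 2 ≤ b) :
    ∃ C : ℝ, ∀ a m : ℤ, Int.gcd a (b : ℤ) = 1 → ∀ N : ℕ, 1 ≤ N → ∀ c : ℕ,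
      c ∣ b ^ N → ∀ Q : ℝ, 1 ≤ Q →
        ∑ q ∈ Finset.Icc (-⌊Q⌋) ⌊Q⌋, ‖K2 m a (-a) q c‖ ≤
          C * (Q + (b : ℝ) ^ ((N : ℝ) / 2)) := by
  refine ⟨36 * b ^ 2, fun a m hab N hN c hcb Q hQ => ?_⟩
  have hc0 : 0 < c := Nat.pos_of_dvd_of_pos hcb (by positivity)
  have : NeZero c := ⟨hc0.ne'⟩
  obtain ⟨s, r, hc, hsb⟩ := exists_mul_mul_sq_of_dvd_pow (by omega) hcb
  rw [sq, ← mul_assoc] at hc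
  have hac : IsCoprime a (c : ℤ) :=
    ((Int.isCoprime_iff_gcd_eq_one.2 hab).pow_right (n := N)).of_isCoprime_of_dvd_right
      (by exact_mod_cast hcb)
  obtain ⟨n, hn⟩ := Int.eq_ofNat_of_zero_le (Int.floor_nonneg.2 (zero_le_one.trans hQ))
  have hnQ : (n : ℝ) ≤ Q := by
    have := Int.floor_le Q
    rw [hn] at this
    exact_mod_cast this
  have hsle : (s : ℝ) ≤ b := by exact_mod_cast Nat.le_of_dvd (by omega) hsb
  have hrle : (r : ℝ) ≤ (b : ℝ) ^ ((N : ℝ) / 2) := by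
    have h1 : (r : ℝ) ^ 2 ≤ (b : ℝ) ^ N := by
      exact_mod_cast Nat.le_of_dvd (by positivity)
        ((Dvd.intro_left s (by rw [hc]; ring) : r ^ 2 ∣ c).trans hcb)
    refine (sq_le_sq₀ (by positivity) (by positivity)).1 (h1.trans_eq ?_)
    rw [← Real.rpow_natCast, ← Real.rpow_natCast, ← Real.rpow_mul (by positivity)]
    congr 1
    push_cast
    ring
  have h1 : ∑ q ∈ Icc (-⌊Q⌋) ⌊Q⌋, ‖K2 m a (-a) q c‖ ≤
      ((36 * b * s * n + 3 * b * (s * r) : ℕ) : ℝ) := by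
    rw [hn]
    refine (sum_le_sum fun q _ =>
      norm_K2_le_card_stationaryPoints hc (Dvd.intro_left s rfl) m a q).trans ?_
    exact_mod_cast sum_card_stationaryPoints_le (by omega) hc0 hc hcb hac n
  refine h1.trans ?_
  push_cast
  calc (36 * b * s * n + 3 * b * (s * r) : ℝ)
      ≤ 36 * b * b * Q + 36 * b * (b * (b : ℝ) ^ ((N : ℝ) / 2)) := by
        gcongr
        norm_num
    _ = _ := by ring
end
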